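/- arXiv:2206.11227 — 5 statements merged into one kernel-verified Lean document; each statement's English description precedes it below -/
import Mathlib

section
/- Let K ⊂ ℝ^d be a convex body of volume 1. For k ∈ ℕ let f_{S_k} : ℝ^d → ℝ be the density of S_k = 2^{−k} ∑_{i=1}^{2^k} X_i, where X₁, X₂, … are independent uniformly random points of K; explicitly f_{S_k}(z) = 2^{kd} · (1_K ∗ ⋯ ∗ 1_K)(2^k z), the 2^k-fold convolution of the indicator of K evaluated at 2^k z and rescaled. Then for every k ≥ 1 and every z ∈ ℝ^d, f_{S_k}(z) ≤ (f_{S_1}(z))^{2^k − 1}, where f_{S_1}(z) = 2^d · vol(K ∩ (2z − K)). -/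
open MeasureTheory Pointwise

/-- `convIter f n` is the `(n+1)`-fold convolution `f ⋆ f ⋆ ⋯ ⋆ f` (with `n + 1`
copies of `f`) with respect to Lebesgue measure. -/
noncomputable def convIter {d : ℕ} (f : EuclideanSpace ℝ (Fin d) → ℝ) :
    ℕ → EuclideanSpace ℝ (Fin d) → ℝ
  | 0 => f
  | n + 1 => MeasureTheory.convolution f (convIter f n) (ContinuousLinearMap.mul ℝ ℝ) volume

/-- The density of the average `n⁻¹ (X₁ + ⋯ + Xₙ)` of `n` independent uniformly random
points of `K`: `z ↦ n^d · (1_K ⋆ ⋯ ⋆ 1_K)(n z)`, the `n`-fold convolution of the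
indicator of `K`, evaluated at `n z` and rescaled. -/
noncomputable def avgDensity {d : ℕ} (K : Set (EuclideanSpace ℝ (Fin d))) (n : ℕ)
    (z : EuclideanSpace ℝ (Fin d)) : ℝ :=
  (n : ℝ) ^ d * convIter (K.indicator 1) (n - 1) ((n : ℝ) • z)

section PrekopaLeindler

open scoped ENNReal

/-- The one-dimensional Brunn–Minkowski inequality for compact sets. -/
lemma volume_add_volume_le_of_isCompact {A B : Set ℝ} (hA : IsCompact A) (hB : IsCompact B)
    (hA' : A.Nonempty) (hB' : B.Nonempty) : volume A + volume B ≤ volume (A + B) := by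
  obtain ⟨a, ha, hmax⟩ := hA.exists_isGreatest hA'
  obtain ⟨b, hb, hmin⟩ := hB.exists_isLeast hB'
  have hdisj : AEDisjoint volume ((fun x => x + b) '' A) ((fun x => a + x) '' B) := by
    refine measure_mono_null (t := {a + b}) ?_ (by simp)
    rintro _ ⟨⟨x, hx, rfl⟩, y, hy, hxy⟩
    have h₁ := hmax hx
    have h₂ := hmin hy
    simp only [Set.mem_singleton_iff] at hxy ⊢
    linarith
  have hmeas : NullMeasurableSet ((fun x => a + x) '' B) volume :=
    (hB.image (by fun_prop)).measurableSet.nullMeasurableSet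
  calc volume A + volume B
      = volume ((fun x => x + b) '' A) + volume ((fun x => a + x) '' B) := by simp
    _ = volume ((fun x => x + b) '' A ∪ (fun x => a + x) '' B) :=
        (measure_union₀ hmeas hdisj).symm
    _ ≤ volume (A + B) := by
        refine measure_mono (Set.union_subset ?_ ?_)
        · rintro _ ⟨x, hx, rfl⟩
          exact Set.add_mem_add hx hb
        · rintro _ ⟨y, hy, rfl⟩
          exact Set.add_mem_add ha hy

/-- The one-dimensional Brunn–Minkowski inequality for measurable sets. -/
lemma volume_add_volume_le_two_mul {A B C : Set ℝ} (hA : MeasurableSet A) (hB : MeasurableSet B)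
    (hA' : A.Nonempty) (hB' : B.Nonempty)
    (hC : ∀ x ∈ A, ∀ y ∈ B, (2⁻¹ : ℝ) • (x + y) ∈ C) :
    volume A + volume B ≤ 2 * volume C := by
  obtain ⟨a, ha⟩ := hA'
  obtain ⟨b, hb⟩ := hB'
  have hcompact : ∀ A' ⊆ A, IsCompact A' → ∀ B' ⊆ B, IsCompact B' →
      volume A' + volume B' ≤ 2 * volume C := by
    intro A' hAA hAc B' hBB hBc
    have hsub : insert a A' + insert b B' ⊆ (2 : ℝ) • C := by
      rintro _ ⟨x, hx, y, hy, rfl⟩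
      refine ⟨_, hC x (Set.insert_subset ha hAA hx) y (Set.insert_subset hb hBB hy), ?_⟩
      simp
    calc volume A' + volume B' ≤ volume (insert a A') + volume (insert b B') := by
          gcongr <;> exact Set.subset_insert _ _
      _ ≤ volume (insert a A' + insert b B') :=
          volume_add_volume_le_of_isCompact (hAc.insert a) (hBc.insert b)
            (Set.insert_nonempty _ _) (Set.insert_nonempty _ _)
      _ ≤ volume ((2 : ℝ) • C) := measure_mono hsub
      _ = 2 * volume C := by simp [Measure.addHaar_smul]
  rw [hA.measure_eq_iSup_isCompact, hB.measure_eq_iSup_isCompact]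
  simp only [iSup_and']
  refine ENNReal.biSup_add_biSup_le' ⟨∅, by simp⟩ ⟨∅, by simp⟩ ?_
  rintro A' ⟨h₁, h₂⟩ B' ⟨h₃, h₄⟩
  exact hcompact A' h₁ h₂ B' h₃ h₄

lemma mul_le_sq_of_add_le_two_mul {u v w : ℝ≥0∞} (h : u + v ≤ 2 * w) : u * v ≤ w ^ 2 := by
  rcases eq_or_ne w ⊤ with rfl | hw
  · simp
  have huv : u + v ≠ ⊤ := ne_top_of_le_ne_top (by finiteness) h
  lift w to NNReal using hw
  lift u to NNReal using (ENNReal.add_ne_top.1 huv).1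
  lift v to NNReal using (ENNReal.add_ne_top.1 huv).2
  norm_cast at h ⊢
  have h' : (u : ℝ) + v ≤ 2 * w := by exact_mod_cast h
  suffices (u : ℝ) * v ≤ w ^ 2 by exact_mod_cast this
  nlinarith [sq_nonneg ((u : ℝ) - v), u.2, v.2, w.2]

/-- The Prékopa–Leindler inequality on the line for functions of supremum one. -/
lemma lintegral_ofReal_mul_le_sq {f g h : ℝ → ℝ} (hf : Measurable f) (hg : Measurable g)
    (hh : Measurable h) (hf0 : 0 ≤ f) (hg0 : 0 ≤ g) (hh0 : 0 ≤ h)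
    (hf1 : ∀ x, f x ≤ 1) (hg1 : ∀ x, g x ≤ 1)
    (hfs : ∀ t, 0 ≤ t → t < 1 → ∃ x, t < f x) (hgs : ∀ t, 0 ≤ t → t < 1 → ∃ x, t < g x)
    (H : ∀ x y, f x * g y ≤ h ((2⁻¹ : ℝ) • (x + y)) ^ 2) :
    (∫⁻ x, ENNReal.ofReal (f x)) * (∫⁻ x, ENNReal.ofReal (g x)) ≤
      (∫⁻ x, ENNReal.ofReal (h x)) ^ 2 := by
  apply mul_le_sq_of_add_le_two_mul
  rw [lintegral_eq_lintegral_meas_lt _ (.of_forall hf0) hf.aemeasurable,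
    lintegral_eq_lintegral_meas_lt _ (.of_forall hg0) hg.aemeasurable,
    lintegral_eq_lintegral_meas_lt _ (.of_forall hh0) hh.aemeasurable]
  rw [← lintegral_const_mul' _ _ (by simp)]
  refine (le_lintegral_add _ _).trans (setLIntegral_mono' measurableSet_Ioi fun t ht => ?_)
  rcases lt_or_ge t 1 with ht1 | ht1
  · refine volume_add_volume_le_two_mul (measurableSet_lt measurable_const hf)
      (measurableSet_lt measurable_const hg) (hfs t ht.le ht1) (hgs t ht.le ht1) ?_
    intro x hx y hy
    refine lt_of_pow_lt_pow_left₀ 2 (hh0 _) (lt_of_lt_of_le ?_ (H x y))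
    rw [sq]
    exact mul_lt_mul'' hx hy ht.le ht.le
  · have hf' : {x | t < f x} = ∅ := by
      ext x; simpa using (hf1 x).trans ht1
    have hg' : {x | t < g x} = ∅ := by
      ext x; simpa using (hg1 x).trans ht1
    simp [hf', hg']

/-- The Prékopa–Leindler inequality on the line for bounded functions. -/
lemma lintegral_mul_le_sq_of_bounded {f g h : ℝ → ℝ≥0∞} (hf : Measurable f) (hg : Measurable g)
    (hh : Measurable h) (hfb : ⨆ x, f x ≠ ⊤) (hgb : ⨆ x, g x ≠ ⊤)
    (H : ∀ x y, f x * g y ≤ h ((2⁻¹ : ℝ) • (x + y)) ^ 2) :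
    (∫⁻ x, f x) * (∫⁻ x, g x) ≤ (∫⁻ x, h x) ^ 2 := by
  set a := ⨆ x, f x with ha
  set b := ⨆ x, g x with hb
  have hfa : ∀ x, f x ≤ a := le_iSup f
  have hgb' : ∀ x, g x ≤ b := le_iSup g
  rcases eq_or_ne a 0 with ha0 | ha0
  · have : ∀ x, f x = 0 := fun x => by simpa [ha0] using hfa x
    simp [this]
  rcases eq_or_ne b 0 with hb0 | hb0
  · have : ∀ x, g x = 0 := fun x => by simpa [hb0] using hgb' x
    simp [this]
  obtain ⟨c, hc⟩ : ∃ c : ℝ≥0∞, c ^ 2 = a * b :=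
    ⟨(a * b) ^ (2⁻¹ : ℝ), by rw [← ENNReal.rpow_natCast, ← ENNReal.rpow_mul]; simp⟩
  have habt : a * b ≠ ⊤ := ENNReal.mul_ne_top hfb hgb
  have hc0 : c ≠ 0 := by rintro rfl; simp [eq_comm, ha0, hb0] at hc
  have hct : c ≠ ⊤ := by rintro rfl; exact habt (by simpa using hc.symm)
  have hdiv1 : ∀ {u v : ℝ≥0∞}, u ≤ v → u / v ≤ 1 := fun huv =>
    ENNReal.div_le_of_le_mul (by simpa using huv)
  have hdivt : ∀ {u v : ℝ≥0∞}, u ≤ v → u / v ≠ ⊤ := fun huv =>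
    ne_top_of_le_ne_top ENNReal.one_ne_top (hdiv1 huv)
  have hsup : ∀ {φ : ℝ → ℝ≥0∞} {m : ℝ≥0∞}, m = ⨆ x, φ x → m ≠ 0 → m ≠ ⊤ →
      ∀ t, 0 ≤ t → t < 1 → ∃ x, t < (φ x / m).toReal := by
    intro φ m hm hm0 hmt t ht0 ht1
    have hlt : ENNReal.ofReal t * m < ⨆ x, φ x := by
      rw [← hm]
      calc ENNReal.ofReal t * m < 1 * m :=
            ENNReal.mul_lt_mul_left hm0 hmt (by simpa using ht1)
        _ = m := one_mul m
    obtain ⟨x, hx⟩ := lt_iSup_iff.1 hlt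
    refine ⟨x, (ENNReal.ofReal_lt_iff_lt_toReal ht0 (hdivt (hm ▸ le_iSup φ x))).1 ?_⟩
    rwa [ENNReal.lt_div_iff_mul_lt (.inl hm0) (.inl hmt)]
  have key := lintegral_ofReal_mul_le_sq (f := fun x => (f x / a).toReal)
    (g := fun x => (g x / b).toReal) (h := fun x => (min (h x) c / c).toReal)
    (by fun_prop) (by fun_prop) (by fun_prop) (fun _ => ENNReal.toReal_nonneg)
    (fun _ => ENNReal.toReal_nonneg) (fun _ => ENNReal.toReal_nonneg)
    (fun x => ENNReal.toReal_le_of_le_ofReal zero_le_one (by simpa using hdiv1 (hfa x)))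
    (fun x => ENNReal.toReal_le_of_le_ofReal zero_le_one (by simpa using hdiv1 (hgb' x)))
    (hsup ha ha0 hfb) (hsup hb hb0 hgb) (fun x y => by
      rw [← ENNReal.toReal_mul, ← ENNReal.toReal_pow]
      refine ENNReal.toReal_mono (ENNReal.pow_ne_top (hdivt (min_le_right _ _))) ?_
      have h₁ : f x * g y ≤ min (h ((2⁻¹ : ℝ) • (x + y))) c ^ 2 := by
        rcases min_choice (h ((2⁻¹ : ℝ) • (x + y))) c with hm | hm <;> rw [hm]
        · exact H x y
        · rw [hc]; exact mul_le_mul' (hfa x) (hgb' y)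
      calc f x / a * (g y / b) = f x * g y / c ^ 2 := by
            rw [hc, div_eq_mul_inv, div_eq_mul_inv, div_eq_mul_inv,
              ENNReal.mul_inv (.inl ha0) (.inl hfb)]
            ring
        _ ≤ min (h ((2⁻¹ : ℝ) • (x + y))) c ^ 2 / c ^ 2 := by gcongr
        _ = _ := by rw [div_eq_mul_inv, div_eq_mul_inv, mul_pow, ENNReal.inv_pow])
  simp only [ENNReal.ofReal_toReal (hdivt (hfa _)), ENNReal.ofReal_toReal (hdivt (hgb' _)),
    ENNReal.ofReal_toReal (hdivt (min_le_right _ _))] at key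
  have hfi : ∫⁻ x, f x = a * ∫⁻ x, f x / a := by
    rw [← lintegral_const_mul' _ _ hfb]
    simp only [ENNReal.mul_div_cancel ha0 hfb]
  have hgi : ∫⁻ x, g x = b * ∫⁻ x, g x / b := by
    rw [← lintegral_const_mul' _ _ hgb]
    simp only [ENNReal.mul_div_cancel hb0 hgb]
  calc (∫⁻ x, f x) * ∫⁻ x, g x
      = c ^ 2 * ((∫⁻ x, f x / a) * ∫⁻ x, g x / b) := by rw [hfi, hgi, hc]; ring
    _ ≤ c ^ 2 * (∫⁻ x, min (h x) c / c) ^ 2 := by gcongr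
    _ = (∫⁻ x, min (h x) c) ^ 2 := by
        rw [← mul_pow, ← lintegral_const_mul' _ _ hct]
        simp only [ENNReal.mul_div_cancel hc0 hct]
    _ ≤ (∫⁻ x, h x) ^ 2 := by
        gcongr
        exact min_le_left _ _

/-- A measure on a real vector space satisfies the midpoint Prékopa–Leindler inequality. -/
def SatisfiesPrekopaLeindler {E : Type*} [AddCommGroup E] [Module ℝ E] [MeasurableSpace E]
    (μ : Measure E) : Prop :=
  ∀ f g h : E → ℝ≥0∞, Measurable f → Measurable g → Measurable h →
    (∀ x y, f x * g y ≤ h ((2⁻¹ : ℝ) • (x + y)) ^ 2) →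
    (∫⁻ x, f x ∂μ) * (∫⁻ x, g x ∂μ) ≤ (∫⁻ x, h x ∂μ) ^ 2

lemma satisfiesPrekopaLeindler_real : SatisfiesPrekopaLeindler (volume : Measure ℝ) := by
  intro f g h hf hg hh H
  have htrunc : ∀ {φ : ℝ → ℝ≥0∞}, Measurable φ →
      ∫⁻ x, φ x = ⨆ n : ℕ, ∫⁻ x, min (φ x) n := by
    intro φ hφ
    rw [← lintegral_iSup (fun n => by fun_prop)]
    · congr with x
      rw [← inf_iSup_eq (φ x), ENNReal.iSup_natCast, inf_top_eq]
    · intro m n hmn x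
      dsimp only
      gcongr
  have hbdd : ∀ (φ : ℝ → ℝ≥0∞) (n : ℕ), ⨆ x, min (φ x) n ≠ ⊤ := fun φ n =>
    ne_top_of_le_ne_top (ENNReal.natCast_ne_top n) (iSup_le fun _ => min_le_right _ _)
  rw [htrunc hf, htrunc hg]
  simp only [ENNReal.iSup_mul, ENNReal.mul_iSup, iSup_le_iff]
  intro n m
  refine lintegral_mul_le_sq_of_bounded (by fun_prop) (by fun_prop) hh (hbdd f m) (hbdd g n)
    fun x y => ?_
  exact (mul_le_mul' (min_le_left _ _) (min_le_left _ _)).trans (H x y)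

variable {E F : Type*} [AddCommGroup E] [Module ℝ E] [MeasurableSpace E]
  [AddCommGroup F] [Module ℝ F] [MeasurableSpace F] {μ : Measure E} {ν : Measure F}

lemma SatisfiesPrekopaLeindler.prod [SFinite μ] [SFinite ν] (hμ : SatisfiesPrekopaLeindler μ)
    (hν : SatisfiesPrekopaLeindler ν) : SatisfiesPrekopaLeindler (μ.prod ν) := by
  intro f g h hf hg hh H
  rw [lintegral_prod _ hf.aemeasurable, lintegral_prod _ hg.aemeasurable,
    lintegral_prod _ hh.aemeasurable]
  refine hμ _ _ _ hf.lintegral_prod_right' hg.lintegral_prod_right' hh.lintegral_prod_right'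
    fun x y => ?_
  exact hν _ _ _ (by fun_prop) (by fun_prop) (by fun_prop) fun x' y' => H (x, x') (y, y')

lemma SatisfiesPrekopaLeindler.of_measurePreserving (hμ : SatisfiesPrekopaLeindler μ) (e : E → F)
    (he : MeasurePreserving e μ ν) (hmid : ∀ x y, e ((2⁻¹ : ℝ) • (x + y)) =
      (2⁻¹ : ℝ) • (e x + e y)) : SatisfiesPrekopaLeindler ν := by
  intro f g h hf hg hh H
  rw [← he.lintegral_comp hf, ← he.lintegral_comp hg, ← he.lintegral_comp hh]
  refine hμ _ _ _ (hf.comp he.measurable) (hg.comp he.measurable) (hh.comp he.measurable)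
    fun x y => ?_
  rw [hmid]
  exact H _ _

lemma satisfiesPrekopaLeindler_pi (n : ℕ) :
    SatisfiesPrekopaLeindler (volume : Measure (Fin n → ℝ)) := by
  induction n with
  | zero =>
    intro f g h hf hg hh H
    rw [Measure.volume_pi_eq_dirac 0]
    simpa [lintegral_dirac] using H 0 0
  | succ n ih =>
    refine (satisfiesPrekopaLeindler_real.prod ih).of_measurePreserving _
      (volume_preserving_piFinSuccAbove (fun _ => ℝ) 0).symm fun x y => ?_
    ext i
    refine Fin.cases ?_ (fun j => ?_) i <;> simp [MeasurableEquiv.piFinSuccAbove, mul_add]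

lemma satisfiesPrekopaLeindler_euclideanSpace (n : ℕ) :
    SatisfiesPrekopaLeindler (volume : Measure (EuclideanSpace ℝ (Fin n))) :=
  (satisfiesPrekopaLeindler_pi n).of_measurePreserving _ (PiLp.volume_preserving_toLp (Fin n))
    fun _ _ => rfl

/-- The multiplicative Brunn–Minkowski inequality for midpoints. -/
lemma SatisfiesPrekopaLeindler.measure_mul_measure_le (hμ : SatisfiesPrekopaLeindler μ)
    {A B C : Set E} (hA : MeasurableSet A) (hB : MeasurableSet B) (hC : MeasurableSet C)
    (H : ∀ x ∈ A, ∀ y ∈ B, (2⁻¹ : ℝ) • (x + y) ∈ C) : μ A * μ B ≤ μ C ^ 2 := by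
  rw [← lintegral_indicator_one hA, ← lintegral_indicator_one hB, ← lintegral_indicator_one hC]
  refine hμ _ _ _ (measurable_one.indicator hA) (measurable_one.indicator hB)
    (measurable_one.indicator hC) fun x y => ?_
  by_cases hx : x ∈ A <;> by_cases hy : y ∈ B <;> simp [-smul_add, hx, hy, H]

end PrekopaLeindler

section Convolution

variable {d : ℕ}

/-- Nonnegative bounded integrable functions, a class stable under convolution. -/
structure IsBoundedDensity (f : EuclideanSpace ℝ (Fin d) → ℝ) : Prop where
  integrable : Integrable f
  nonneg : ∀ x, 0 ≤ f x
  bounded : ∃ C, ∀ x, f x ≤ C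

variable {f g h : EuclideanSpace ℝ (Fin d) → ℝ}

lemma IsBoundedDensity.norm_eq (hf : IsBoundedDensity f) : (fun x => ‖f x‖) = f :=
  funext fun x => Real.norm_of_nonneg (hf.nonneg x)

lemma IsBoundedDensity.convolutionExists (hf : IsBoundedDensity f) (hg : IsBoundedDensity g) :
    ConvolutionExists f g (ContinuousLinearMap.mul ℝ ℝ) volume := by
  intro x
  obtain ⟨C, hC⟩ := hg.bounded
  refine BddAbove.convolutionExistsAt (s := Set.univ) _ ⟨C, ?_⟩ MeasurableSet.univ
    (Set.subset_univ _) hf.integrable.integrableOn hg.integrable.aestronglyMeasurable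
  rw [hg.norm_eq]
  rintro _ ⟨y, -, rfl⟩
  exact hC y

lemma IsBoundedDensity.convolution (hf : IsBoundedDensity f) (hg : IsBoundedDensity g) :
    IsBoundedDensity (MeasureTheory.convolution f g (ContinuousLinearMap.mul ℝ ℝ) volume) where
  integrable := hf.integrable.integrable_convolution _ hg.integrable
  nonneg x := integral_nonneg fun t => mul_nonneg (hf.nonneg _) (hg.nonneg _)
  bounded := by
    obtain ⟨C, hC⟩ := hg.bounded
    refine ⟨∫ t, f t * C, fun x => ?_⟩
    refine integral_mono (hf.convolutionExists hg x) (hf.integrable.mul_const C) fun t => ?_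
    exact mul_le_mul_of_nonneg_left (hC _) (hf.nonneg t)

lemma IsBoundedDensity.convolution_assoc (hf : IsBoundedDensity f) (hg : IsBoundedDensity g)
    (hh : IsBoundedDensity h) :
    MeasureTheory.convolution (MeasureTheory.convolution f g (ContinuousLinearMap.mul ℝ ℝ) volume)
        h (ContinuousLinearMap.mul ℝ ℝ) volume =
      MeasureTheory.convolution f
        (MeasureTheory.convolution g h (ContinuousLinearMap.mul ℝ ℝ) volume)
        (ContinuousLinearMap.mul ℝ ℝ) volume := by
  ext x
  refine MeasureTheory.convolution_assoc _ _ _ _ (fun a b c => mul_assoc a b c)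
    hf.integrable.aestronglyMeasurable hg.integrable.aestronglyMeasurable
    hh.integrable.aestronglyMeasurable (.of_forall (hf.convolutionExists hg)) ?_ ?_
  · rw [hg.norm_eq, hh.norm_eq]
    exact .of_forall (hg.convolutionExists hh)
  · rw [hf.norm_eq, hg.norm_eq, hh.norm_eq]
    exact hf.convolutionExists (hg.convolution hh) x

lemma IsBoundedDensity.convIter (hf : IsBoundedDensity f) (n : ℕ) :
    IsBoundedDensity (convIter f n) := by
  induction n with
  | zero => exact hf
  | succ n ih => exact hf.convolution ih

lemma convIter_add_add_one (hf : IsBoundedDensity f) (m n : ℕ) :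
    convIter f (m + n + 1) = MeasureTheory.convolution (convIter f m) (convIter f n)
      (ContinuousLinearMap.mul ℝ ℝ) volume := by
  induction m with
  | zero => rw [Nat.zero_add]; rfl
  | succ m ih =>
    rw [Nat.add_right_comm m 1 n]
    change MeasureTheory.convolution f (convIter f (m + n + 1)) _ _ = _
    rw [ih, ← hf.convolution_assoc (hf.convIter m) (hf.convIter n)]
    rfl

end Convolution

section AvgDensity

variable {d : ℕ} {K : Set (EuclideanSpace ℝ (Fin d))}

lemma isBoundedDensity_indicator (hK : IsCompact K) :
    IsBoundedDensity (K.indicator (1 : EuclideanSpace ℝ (Fin d) → ℝ)) where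
  integrable := (integrable_indicator_iff hK.measurableSet).2
    (integrableOn_const hK.measure_lt_top.ne)
  nonneg := Set.indicator_nonneg fun _ _ => zero_le_one
  bounded := ⟨1, Set.indicator_le_self' (fun _ _ => zero_le_one)⟩

lemma avgDensity_nonneg (hK : IsCompact K) (n : ℕ) (z : EuclideanSpace ℝ (Fin d)) :
    0 ≤ avgDensity K n z :=
  mul_nonneg (by positivity) (((isBoundedDensity_indicator hK).convIter _).nonneg _)

lemma avgDensity_one (z : EuclideanSpace ℝ (Fin d)) :
    avgDensity K 1 z = K.indicator 1 z := by
  simp [avgDensity, convIter]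

/-- The average of `2n` points is the average of two independent averages of `n` points. -/
lemma avgDensity_two_mul (hK : IsCompact K) {n : ℕ} (hn : 0 < n)
    (z : EuclideanSpace ℝ (Fin d)) :
    avgDensity K (2 * n) z =
      2 ^ d * ∫ y, avgDensity K n (z + y) * avgDensity K n (z - y) := by
  have hidx : 2 * n - 1 = (n - 1) + (n - 1) + 1 := by omega
  set φ := convIter (K.indicator (1 : EuclideanSpace ℝ (Fin d) → ℝ)) (n - 1) with hφ
  have hn' : (n : ℝ) ≠ 0 := by positivity
  have hconv : convIter (K.indicator (1 : EuclideanSpace ℝ (Fin d) → ℝ)) (2 * n - 1)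
      (((2 * n : ℕ) : ℝ) • z) = ∫ t, φ t * φ (((2 * n : ℕ) : ℝ) • z - t) := by
    rw [hidx, convIter_add_add_one (isBoundedDensity_indicator hK)]
    rfl
  have hsubst : ∫ y, φ ((n : ℝ) • (z + y)) * φ ((n : ℝ) • (z - y)) =
      ((n : ℝ) ^ d)⁻¹ * ∫ t, φ t * φ (((2 * n : ℕ) : ℝ) • z - t) := by
    rw [← integral_add_left_eq_self (fun t => φ t * φ (((2 * n : ℕ) : ℝ) • z - t)) ((n : ℝ) • z)]
    have := Measure.integral_comp_smul (volume : Measure (EuclideanSpace ℝ (Fin d)))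
      (fun t => φ ((n : ℝ) • z + t) * φ (((2 * n : ℕ) : ℝ) • z - ((n : ℝ) • z + t))) (n : ℝ)
    rw [finrank_euclideanSpace_fin, abs_of_nonneg (by positivity), smul_eq_mul] at this
    rw [← this]
    congr with y
    congr 2
    · module
    · push_cast
      module
  have hpull : ∫ y, avgDensity K n (z + y) * avgDensity K n (z - y) =
      ((n : ℝ) ^ d) ^ 2 * ∫ y, φ ((n : ℝ) • (z + y)) * φ ((n : ℝ) • (z - y)) := by
    rw [← integral_const_mul]
    congr with y
    simp only [avgDensity, ← hφ]
    ring
  rw [hpull, hsubst, avgDensity, hconv]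
  push_cast
  rw [mul_pow]
  field_simp

/-- The symmetric part of `K` about `z`, translated to the origin. -/
def symmetricPart (K : Set (EuclideanSpace ℝ (Fin d))) (z : EuclideanSpace ℝ (Fin d)) :
    Set (EuclideanSpace ℝ (Fin d)) :=
  {y | z + y ∈ K ∧ z - y ∈ K}

lemma isCompact_symmetricPart (hK : IsCompact K) (z : EuclideanSpace ℝ (Fin d)) :
    IsCompact (symmetricPart K z) :=
  ((Homeomorph.addLeft z).isCompact_preimage.2 hK).inter_right
    (hK.isClosed.preimage (by fun_prop : Continuous fun y => z - y))

lemma volume_inter_image_sub (z : EuclideanSpace ℝ (Fin d)) :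
    volume (K ∩ (fun w => (2 : ℝ) • z - w) '' K) = volume (symmetricPart K z) := by
  rw [← measure_preimage_add volume z]
  congr 1
  ext y
  refine and_congr Iff.rfl ⟨?_, fun hy => ⟨z - y, hy, by simp only; module⟩⟩
  rintro ⟨w, hw, hwy⟩
  have hwy' : (2 : ℝ) • z - w = z + y := hwy
  have : z - y = w := by
    rw [eq_sub_of_add_eq' hwy'.symm]
    module
  exact this ▸ hw

lemma avgDensity_two (hK : IsCompact K) (z : EuclideanSpace ℝ (Fin d)) :
    avgDensity K 2 z = 2 ^ d * volume.real (symmetricPart K z) := by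
  have h := avgDensity_two_mul hK one_pos z
  rw [mul_one] at h
  rw [h, ← integral_indicator_one (isCompact_symmetricPart hK z).measurableSet]
  congr with y
  simp only [avgDensity_one]
  by_cases h₁ : z + y ∈ K <;> by_cases h₂ : z - y ∈ K <;> simp [symmetricPart, h₁, h₂]

lemma avgDensity_two_eq_zero (hK : IsCompact K) (hconv : Convex ℝ K)
    {z : EuclideanSpace ℝ (Fin d)} (hz : z ∉ K) : avgDensity K 2 z = 0 := by
  have hempty : symmetricPart K z = ∅ := by
    refine Set.eq_empty_of_forall_notMem fun y hy => hz ?_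
    convert hconv hy.1 hy.2 (by norm_num : (0 : ℝ) ≤ 2⁻¹) (by norm_num : (0 : ℝ) ≤ 2⁻¹)
      (by norm_num) using 1
    module
  simp [avgDensity_two hK, hempty]

lemma avgDensity_two_add_mul_sub_le (hK : IsCompact K) (hconv : Convex ℝ K)
    (z y : EuclideanSpace ℝ (Fin d)) :
    avgDensity K 2 (z + y) * avgDensity K 2 (z - y) ≤ avgDensity K 2 z ^ 2 := by
  have hBM : volume (symmetricPart K (z + y)) * volume (symmetricPart K (z - y)) ≤
      volume (symmetricPart K z) ^ 2 := by
    refine (satisfiesPrekopaLeindler_euclideanSpace d).measure_mul_measure_le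
      (isCompact_symmetricPart hK _).measurableSet (isCompact_symmetricPart hK _).measurableSet
      (isCompact_symmetricPart hK _).measurableSet fun u hu v hv => ⟨?_, ?_⟩
    · convert hconv hu.1 hv.1 (by norm_num : (0 : ℝ) ≤ 2⁻¹) (by norm_num : (0 : ℝ) ≤ 2⁻¹)
        (by norm_num) using 1
      module
    · convert hconv hu.2 hv.2 (by norm_num : (0 : ℝ) ≤ 2⁻¹) (by norm_num : (0 : ℝ) ≤ 2⁻¹)
        (by norm_num) using 1
      module
  have hreal := ENNReal.toReal_mono
    (ENNReal.pow_ne_top (isCompact_symmetricPart hK z).measure_lt_top.ne) hBM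
  rw [ENNReal.toReal_mul, ENNReal.toReal_pow] at hreal
  simp only [avgDensity_two hK, Measure.real]
  calc _ = ((2 : ℝ) ^ d) ^ 2 * ((volume (symmetricPart K (z + y))).toReal *
        (volume (symmetricPart K (z - y))).toReal) := by ring
    _ ≤ ((2 : ℝ) ^ d) ^ 2 * (volume (symmetricPart K z)).toReal ^ 2 := by gcongr
    _ = _ := by ring

lemma avgDensity_two_pow_le (hK : IsCompact K) (hconv : Convex ℝ K) {k : ℕ} (hk : 1 ≤ k)
    (z : EuclideanSpace ℝ (Fin d)) :
    avgDensity K (2 ^ k) z ≤ avgDensity K 2 z ^ (2 ^ k - 1) := by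
  induction k, hk using Nat.le_induction generalizing z with
  | base => simp
  | succ k hk ih =>
    have hk2 : 2 ≤ 2 ^ k := Nat.le_self_pow (by omega) 2
    have hzero : ∀ x ∉ K, avgDensity K (2 ^ k) x = 0 := fun x hx =>
      le_antisymm ((ih x).trans_eq (by
        rw [avgDensity_two_eq_zero hK hconv hx, zero_pow (by omega)])) (avgDensity_nonneg hK _ x)
    set c := (avgDensity K 2 z ^ 2) ^ (2 ^ k - 1) with hc
    have hc0 : 0 ≤ c := by positivity
    have hL := isCompact_symmetricPart hK z
    have hpoint : ∀ y, avgDensity K (2 ^ k) (z + y) * avgDensity K (2 ^ k) (z - y) ≤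
        (symmetricPart K z).indicator (fun _ => c) y := by
      intro y
      by_cases hy : y ∈ symmetricPart K z
      · rw [Set.indicator_of_mem hy]
        calc _ ≤ avgDensity K 2 (z + y) ^ (2 ^ k - 1) * avgDensity K 2 (z - y) ^ (2 ^ k - 1) :=
              mul_le_mul (ih _) (ih _) (avgDensity_nonneg hK _ _)
                (pow_nonneg (avgDensity_nonneg hK _ _) _)
          _ ≤ c := by
              rw [← mul_pow]
              exact pow_le_pow_left₀
                (mul_nonneg (avgDensity_nonneg hK _ _) (avgDensity_nonneg hK _ _))
                (avgDensity_two_add_mul_sub_le hK hconv z y) _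
      · rw [Set.indicator_of_notMem hy]
        rcases not_and_or.1 hy with h | h <;> simp [hzero _ h]
    have hexp : 2 ^ (k + 1) - 1 = 2 * (2 ^ k - 1) + 1 := by rw [pow_succ]; omega
    calc avgDensity K (2 ^ (k + 1)) z
        = 2 ^ d * ∫ y, avgDensity K (2 ^ k) (z + y) * avgDensity K (2 ^ k) (z - y) := by
          rw [pow_succ', avgDensity_two_mul hK (by positivity)]
      _ ≤ 2 ^ d * ∫ y, (symmetricPart K z).indicator (fun _ => c) y := by
          refine mul_le_mul_of_nonneg_left ?_ (by positivity)
          refine integral_mono_of_nonneg (.of_forall fun y =>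
            mul_nonneg (avgDensity_nonneg hK _ _) (avgDensity_nonneg hK _ _)) ?_
            (.of_forall hpoint)
          exact (integrable_indicator_iff hL.measurableSet).2
            (integrableOn_const hL.measure_lt_top.ne)
      _ = avgDensity K 2 z ^ (2 ^ (k + 1) - 1) := by
          rw [integral_indicator_const _ hL.measurableSet, hexp, pow_succ, pow_mul, ← hc,
            avgDensity_two hK z, smul_eq_mul]
          ring

end AvgDensity

/-- Let `K ⊆ ℝ^d` be a convex body of volume `1`, and for `k ∈ ℕ` let
`f_{S_k} = avgDensity K (2^k)` be the density of `S_k = 2^{-k} ∑_{i=1}^{2^k} X_i`, where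
the `X_i` are independent uniformly random points of `K`. Then
`f_{S_1}(z) = 2^d · vol(K ∩ (2z - K))`, and for every `k ≥ 1` and every `z`,
`f_{S_k}(z) ≤ (f_{S_1}(z))^(2^k - 1)`. -/
theorem iterated_sum_control {d : ℕ} (K : Set (EuclideanSpace ℝ (Fin d)))
    (hcpt : IsCompact K) (hconv : Convex ℝ K) (hint : (interior K).Nonempty)
    (hvol : volume K = 1) :
    (∀ z : EuclideanSpace ℝ (Fin d),
      avgDensity K (2 ^ 1) z =
        2 ^ d * (volume (K ∩ (fun w => (2 : ℝ) • z - w) '' K)).toReal) ∧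
    ∀ k : ℕ, 1 ≤ k → ∀ z : EuclideanSpace ℝ (Fin d),
      avgDensity K (2 ^ k) z ≤ (avgDensity K (2 ^ 1) z) ^ (2 ^ k - 1) := by
  refine ⟨fun z => ?_, fun k hk z => ?_⟩
  · rw [pow_one, avgDensity_two hcpt, volume_inter_image_sub]
    rfl
  · rw [pow_one]
    exact avgDensity_two_pow_le hcpt hconv hk z
end

section
/- For every convex body K ⊂ ℝ^d (d ≥ 1) whose centre of mass is the origin, vol(K ∩ (−K)) / vol(K) ≥ exp(d/(2^16 · L_K²)) · 2^{−d}, where L_K is the isotropic constant of K. In particular Δ_KB(K) ≥ exp(d/(2^16 · L_K²)) · 2^{−d}. -/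
open MeasureTheory Pointwise

/-- The centre of mass of `K`. -/
noncomputable def centroid {d : ℕ} (K : Set (EuclideanSpace ℝ (Fin d))) :
    EuclideanSpace ℝ (Fin d) :=
  (volume K).toReal⁻¹ • ∫ x in K, x

/-- The covariance matrix `Σ_K = E[(X - E X) ⊗ (X - E X)]` of a uniformly random point
`X` of `K`. -/
noncomputable def covMatrix {d : ℕ} (K : Set (EuclideanSpace ℝ (Fin d))) :
    Matrix (Fin d) (Fin d) ℝ :=
  fun i j => (volume K).toReal⁻¹ * ∫ x in K, (x i - centroid K i) * (x j - centroid K j)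

/-- The isotropic constant `L_K = (√(det Σ_K) / vol(K))^(1/d)`. -/
noncomputable def isotropicConstant {d : ℕ} (K : Set (EuclideanSpace ℝ (Fin d))) : ℝ :=
  (Real.sqrt (covMatrix K).det / (volume K).toReal) ^ ((d : ℝ)⁻¹)

/-- The Kövner–Besicovitch measure of symmetry
`Δ_KB(K) = sup_x vol(K ∩ (x - K)) / vol(K)`. -/
noncomputable def kbSym {d : ℕ} (K : Set (EuclideanSpace ℝ (Fin d))) : ℝ :=
  ⨆ x : EuclideanSpace ℝ (Fin d),
    (volume (K ∩ (fun y => x - y) '' K)).toReal / (volume K).toReal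

/-- The one-dimensional Brunn–Minkowski inequality for compact sets. -/
theorem volume_add_le_of_isCompact {P Q : Set ℝ} (hP : IsCompact P) (hQ : IsCompact Q)
    (hPn : P.Nonempty) (hQn : Q.Nonempty) : volume P + volume Q ≤ volume (P + Q) := by
  obtain ⟨p, hp, hpmax⟩ := hP.exists_isGreatest hPn
  obtain ⟨q, hq, hqmin⟩ := hQ.exists_isLeast hQn
  have hdisj : AEDisjoint volume ((fun x => q + x) '' P) ((fun x => p + x) '' Q) := by
    refine measure_mono_null (t := {p + q}) ?_ (by simp)
    rintro _ ⟨⟨x, hx, rfl⟩, ⟨y, hy, hxy⟩⟩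
    have h1 : x ≤ p := hpmax hx
    have h2 : q ≤ y := hqmin hy
    simp only at hxy ⊢
    rw [Set.mem_singleton_iff]
    linarith
  calc volume P + volume Q
      = volume ((fun x => q + x) '' P) + volume ((fun x => p + x) '' Q) := by
        simp [Set.image_add_left, measure_preimage_add]
    _ = volume ((fun x => q + x) '' P ∪ (fun x => p + x) '' Q) :=
        (measure_union₀ (hQ.image (by fun_prop)).measurableSet.nullMeasurableSet hdisj).symm
    _ ≤ volume (P + Q) := by
        refine measure_mono (Set.union_subset ?_ ?_)
        · rintro _ ⟨x, hx, rfl⟩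
          exact ⟨x, hx, q, hq, add_comm _ _⟩
        · rintro _ ⟨y, hy, rfl⟩
          exact ⟨p, hp, y, hy, rfl⟩

/-- The one-dimensional Brunn–Minkowski inequality for measurable sets. -/
theorem volume_combo_le {A B C : Set ℝ} {a b : ℝ} (ha : 0 < a) (hb : 0 < b)
    (hA : MeasurableSet A) (hB : MeasurableSet B) (hAn : A.Nonempty) (hBn : B.Nonempty)
    (hC : ∀ x ∈ A, ∀ y ∈ B, a * x + b * y ∈ C) :
    ENNReal.ofReal a * volume A + ENNReal.ofReal b * volume B ≤ volume C := by
  obtain ⟨x₀, hx₀⟩ := hAn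
  obtain ⟨y₀, hy₀⟩ := hBn
  have key : ∀ P, P ⊆ A → IsCompact P → ∀ Q, Q ⊆ B → IsCompact Q →
      ENNReal.ofReal a * volume P + ENNReal.ofReal b * volume Q ≤ volume C := by
    intro P hPA hP Q hQB hQ
    have h := volume_add_le_of_isCompact ((hP.insert x₀).smul a) ((hQ.insert y₀).smul b)
      ((Set.insert_nonempty _ _).smul_set) ((Set.insert_nonempty _ _).smul_set)
    rw [Measure.addHaar_smul, Measure.addHaar_smul] at h
    simp only [Module.finrank_self, pow_one, abs_of_pos ha, abs_of_pos hb] at h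
    refine le_trans (add_le_add ?_ ?_) (h.trans (measure_mono ?_))
    · gcongr; exact Set.subset_insert _ _
    · gcongr; exact Set.subset_insert _ _
    · rintro _ ⟨_, ⟨x, hx, rfl⟩, _, ⟨y, hy, rfl⟩, rfl⟩
      exact hC x (Set.insert_subset hx₀ hPA hx) y (Set.insert_subset hy₀ hQB hy)
  rw [hA.measure_eq_iSup_isCompact, hB.measure_eq_iSup_isCompact]
  simp only [ENNReal.mul_iSup, iSup_and']
  exact ENNReal.biSup_add_biSup_le' ⟨∅, by simp⟩ ⟨∅, by simp⟩
    fun P hP Q hQ => key P hP.1 hP.2 Q hQ.1 hQ.2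

/-- A Prékopa–Leindler type inequality for functions whose supremum is `1`. -/
theorem lintegral_combo_le_of_min_le {f g h : ℝ → ℝ} {a b : ℝ} (ha : 0 < a) (hb : 0 < b)
    (hf : Measurable f) (hg : Measurable g) (hh : Measurable h)
    (hf0 : ∀ x, 0 ≤ f x) (hg0 : ∀ x, 0 ≤ g x) (hh0 : ∀ x, 0 ≤ h x)
    (hf1 : ∀ x, f x ≤ 1) (hg1 : ∀ x, g x ≤ 1)
    (hfs : ∀ t < 1, ∃ x, t < f x) (hgs : ∀ t < 1, ∃ x, t < g x)
    (hfgh : ∀ x y, min (f x) (g y) ≤ h (a * x + b * y)) :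
    ENNReal.ofReal a * (∫⁻ x, ENNReal.ofReal (f x)) +
      ENNReal.ofReal b * (∫⁻ x, ENNReal.ofReal (g x)) ≤ ∫⁻ x, ENNReal.ofReal (h x) := by
  rw [lintegral_eq_lintegral_meas_lt volume (.of_forall hf0) hf.aemeasurable,
    lintegral_eq_lintegral_meas_lt volume (.of_forall hg0) hg.aemeasurable,
    lintegral_eq_lintegral_meas_lt volume (.of_forall hh0) hh.aemeasurable]
  have hanti : ∀ u : ℝ → ℝ, Measurable fun t : ℝ => volume {x | t < u x} := fun u =>
    Antitone.measurable fun s t hst => measure_mono fun x hx => lt_of_le_of_lt hst hx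
  rw [← lintegral_const_mul _ (hanti f), ← lintegral_const_mul _ (hanti g),
    ← lintegral_add_left ((hanti f).const_mul _)]
  refine lintegral_mono fun t => ?_
  rcases lt_or_ge t 1 with ht | ht
  · refine volume_combo_le ha hb (measurableSet_lt measurable_const hf)
      (measurableSet_lt measurable_const hg) (hfs t ht) (hgs t ht) fun x hx y hy => ?_
    exact lt_of_lt_of_le (lt_min hx hy) (hfgh x y)
  · have h1 : {x | t < f x} = ∅ := Set.eq_empty_of_forall_notMem fun x hx =>
      absurd (lt_of_lt_of_le hx (hf1 x)) (not_lt.2 ht)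
    have h2 : {x | t < g x} = ∅ := Set.eq_empty_of_forall_notMem fun x hx =>
      absurd (lt_of_lt_of_le hx (hg1 x)) (not_lt.2 ht)
    simp [h1, h2]

theorem ENNReal.rpow_mul_rpow_le_combo {a b : ℝ} (ha : 0 < a) (hb : 0 < b) (hab : a + b = 1)
    (u v : ENNReal) : u ^ a * v ^ b ≤ ENNReal.ofReal a * u + ENNReal.ofReal b * v := by
  rcases eq_or_ne u ⊤ with rfl | hu
  · simp [ENNReal.mul_top, ha]
  rcases eq_or_ne v ⊤ with rfl | hv
  · simp [ENNReal.mul_top, hb]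
  lift u to NNReal using hu
  lift v to NNReal using hv
  lift a to NNReal using ha.le
  lift b to NNReal using hb.le
  rw [← ENNReal.coe_rpow_of_nonneg _ a.coe_nonneg, ← ENNReal.coe_rpow_of_nonneg _ b.coe_nonneg,
    ENNReal.ofReal_coe_nnreal, ENNReal.ofReal_coe_nnreal]
  exact_mod_cast NNReal.geom_mean_le_arith_mean2_weighted a b u v (by exact_mod_cast hab)

theorem prekopa_leindler_real_of_bounded {f g h : ℝ → ENNReal} {a b : ℝ} (ha : 0 < a) (hb : 0 < b)
    (hab : a + b = 1) (hf : Measurable f) (hg : Measurable g) (hh : Measurable h)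
    (hfb : ⨆ x, f x ≠ ⊤) (hgb : ⨆ x, g x ≠ ⊤)
    (hfgh : ∀ x y, f x ^ a * g y ^ b ≤ h (a * x + b * y)) :
    (∫⁻ x, f x) ^ a * (∫⁻ x, g x) ^ b ≤ ∫⁻ x, h x := by
  set F := ⨆ x, f x with hF
  set G := ⨆ x, g x with hG
  rcases eq_or_ne F 0 with hF0 | hF0
  · have : ∀ x, f x = 0 := fun x => le_antisymm (hF0 ▸ le_iSup f x) bot_le
    simp [this, ha]
  rcases eq_or_ne G 0 with hG0 | hG0
  · have : ∀ x, g x = 0 := fun x => le_antisymm (hG0 ▸ le_iSup g x) bot_le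
    simp [this, hb]
  set c := F ^ a * G ^ b with hc
  have hc0 : c ≠ 0 := mul_ne_zero (by simp [hF0, hfb]) (by simp [hG0, hgb])
  have hct : c ≠ ⊤ := ENNReal.mul_ne_top (by simp [hF0, hfb]) (by simp [hG0, hgb])
  have hu1 : ∀ x, f x / F ≤ 1 := fun x => ENNReal.div_le_of_le_mul (by simpa using le_iSup f x)
  have hv1 : ∀ x, g x / G ≤ 1 := fun x => ENNReal.div_le_of_le_mul (by simpa using le_iSup g x)
  have hw1 : ∀ x, min (h x / c) 1 ≠ ⊤ := fun x => ne_top_of_le_ne_top ENNReal.one_ne_top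
    (min_le_right _ _)
  have hut : ∀ x, f x / F ≠ ⊤ := fun x => ne_top_of_le_ne_top ENNReal.one_ne_top (hu1 x)
  have hvt : ∀ x, g x / G ≠ ⊤ := fun x => ne_top_of_le_ne_top ENNReal.one_ne_top (hv1 x)
  have hsup : ∀ {k : ℝ → ENNReal}, ⨆ x, k x ≠ 0 → ⨆ x, k x ≠ ⊤ →
      (∀ x, k x / (⨆ x, k x) ≠ ⊤) → ∀ t < 1, ∃ x, t < (k x / ⨆ x, k x).toReal := by
    intro k h0 ht hkt t ht1
    obtain ⟨x, hx⟩ : ∃ x, ENNReal.ofReal t * (⨆ x, k x) < k x := by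
      refine lt_iSup_iff.1 ?_
      calc ENNReal.ofReal t * (⨆ x, k x) < 1 * ⨆ x, k x :=
            ENNReal.mul_lt_mul_left h0 ht (by simpa using ht1)
        _ = _ := one_mul _
    refine ⟨x, ?_⟩
    have h3 : ENNReal.ofReal t < k x / ⨆ x, k x :=
      (ENNReal.lt_div_iff_mul_lt (Or.inl h0) (Or.inl ht)).2 hx
    rcases lt_or_ge t 0 with h4 | h4
    · exact h4.trans_le ENNReal.toReal_nonneg
    · exact (ENNReal.ofReal_lt_iff_lt_toReal h4 (hkt x)).1 h3
  have key := lintegral_combo_le_of_min_le (f := fun x => (f x / F).toReal)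
    (g := fun x => (g x / G).toReal) (h := fun x => (min (h x / c) 1).toReal) ha hb
    (hf.div_const _).ennreal_toReal (hg.div_const _).ennreal_toReal
    ((hh.div_const _).min measurable_const).ennreal_toReal
    (fun _ => ENNReal.toReal_nonneg) (fun _ => ENNReal.toReal_nonneg)
    (fun _ => ENNReal.toReal_nonneg)
    (fun x => by simpa using ENNReal.toReal_mono ENNReal.one_ne_top (hu1 x))
    (fun x => by simpa using ENNReal.toReal_mono ENNReal.one_ne_top (hv1 x))
    (hsup hF0 hfb hut) (hsup hG0 hgb hvt) (by
      intro x y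
      rw [← ENNReal.toReal_min (hut x) (hvt y)]
      refine ENNReal.toReal_mono (hw1 _) (le_min ?_ ((min_le_left _ _).trans (hu1 x)))
      set m := min (f x / F) (g y / G) with hm
      calc m = m ^ a * m ^ b := by
            rw [← ENNReal.rpow_add_of_nonneg _ _ ha.le hb.le, hab, ENNReal.rpow_one]
        _ ≤ (f x / F) ^ a * (g y / G) ^ b := by
            gcongr
            · exact min_le_left _ _
            · exact min_le_right _ _
        _ = (f x ^ a * g y ^ b) / c := by
            rw [ENNReal.div_rpow_of_nonneg _ _ ha.le, ENNReal.div_rpow_of_nonneg _ _ hb.le, hc,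
              div_eq_mul_inv, div_eq_mul_inv, div_eq_mul_inv, ENNReal.mul_inv]
            · ring
            · left; simp [hF0, hfb]
            · left; simp [hF0, hfb]
        _ ≤ h (a * x + b * y) / c := by
            gcongr
            exact hfgh x y)
  simp only [ENNReal.ofReal_toReal (hut _), ENNReal.ofReal_toReal (hvt _),
    ENNReal.ofReal_toReal (hw1 _)] at key
  have hscale : ∀ {k : ℝ → ENNReal} {C : ENNReal}, Measurable k → C ≠ 0 → C ≠ ⊤ →
      ∫⁻ x, k x = C * ∫⁻ x, k x / C := by
    intro k C hk h0 ht
    rw [← lintegral_const_mul _ (hk.div_const _)]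
    simp [ENNReal.mul_div_cancel h0 ht]
  calc (∫⁻ x, f x) ^ a * (∫⁻ x, g x) ^ b
      = c * ((∫⁻ x, f x / F) ^ a * (∫⁻ x, g x / G) ^ b) := by
        rw [hscale hf hF0 hfb, hscale hg hG0 hgb, ENNReal.mul_rpow_of_nonneg _ _ ha.le,
          ENNReal.mul_rpow_of_nonneg _ _ hb.le, hc]
        ring
    _ ≤ c * ∫⁻ x, min (h x / c) 1 := by
        gcongr
        exact (ENNReal.rpow_mul_rpow_le_combo ha hb hab _ _).trans key
    _ ≤ c * ∫⁻ x, h x / c := by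
        gcongr
        exact min_le_left _ _
    _ = ∫⁻ x, h x := (hscale hh hc0 hct).symm

/-- The Prékopa–Leindler inequality on the line. -/
theorem prekopa_leindler_real {f g h : ℝ → ENNReal} {a b : ℝ} (ha : 0 < a) (hb : 0 < b)
    (hab : a + b = 1) (hf : Measurable f) (hg : Measurable g) (hh : Measurable h)
    (hfgh : ∀ x y, f x ^ a * g y ^ b ≤ h (a * x + b * y)) :
    (∫⁻ x, f x) ^ a * (∫⁻ x, g x) ^ b ≤ ∫⁻ x, h x := by
  have htrunc : ∀ {k : ℝ → ENNReal}, Measurable k →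
      ∫⁻ x, k x = ⨆ n : ℕ, ∫⁻ x, min (k x) n := by
    intro k hk
    rw [← lintegral_iSup (fun n => hk.min measurable_const)
      (fun m n hmn x => min_le_min_left _ (by exact_mod_cast hmn))]
    refine lintegral_congr fun x => ?_
    rw [← inf_iSup_eq, ENNReal.iSup_natCast, inf_top_eq]
  have hbdd : ∀ (k : ℝ → ENNReal) (n : ℕ), ⨆ x, min (k x) n ≠ ⊤ := fun k n =>
    ne_top_of_le_ne_top (ENNReal.natCast_ne_top n) (iSup_le fun x => min_le_right _ _)
  have hrpow : ∀ {r : ℝ} (_ : 0 < r) (s : ℕ → ENNReal), (⨆ n, s n) ^ r = ⨆ n, s n ^ r :=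
    fun hr s => (ENNReal.orderIsoRpow _ hr).map_iSup s
  rw [htrunc hf, htrunc hg, hrpow ha, hrpow hb]
  simp only [ENNReal.mul_iSup, ENNReal.iSup_mul]
  refine iSup_le fun m => iSup_le fun n => ?_
  refine prekopa_leindler_real_of_bounded ha hb hab (hf.min measurable_const)
    (hg.min measurable_const) hh (hbdd _ _) (hbdd _ _) fun x y => le_trans ?_ (hfgh x y)
  gcongr
  · exact min_le_left _ _
  · exact min_le_left _ _

/-- The Prékopa–Leindler inequality on `ℝⁿ`. -/
theorem prekopa_leindler_pi {a b : ℝ} (ha : 0 < a) (hb : 0 < b) (hab : a + b = 1) (n : ℕ)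
    {f g h : (Fin n → ℝ) → ENNReal} (hf : Measurable f) (hg : Measurable g) (hh : Measurable h)
    (hfgh : ∀ x y, f x ^ a * g y ^ b ≤ h (a • x + b • y)) :
    (∫⁻ x, f x) ^ a * (∫⁻ x, g x) ^ b ≤ ∫⁻ x, h x := by
  induction n with
  | zero =>
    rw [Measure.volume_pi_eq_dirac isEmptyElim, lintegral_dirac, lintegral_dirac, lintegral_dirac]
    convert hfgh isEmptyElim isEmptyElim
  | succ n ih =>
    set e := (MeasurableEquiv.piFinSuccAbove (fun _ : Fin (n + 1) => ℝ) 0).symm with he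
    have hmp : MeasurePreserving e := (volume_preserving_piFinSuccAbove (fun _ => ℝ) 0).symm _
    have hfub : ∀ {k : (Fin (n + 1) → ℝ) → ENNReal}, Measurable k →
        ∫⁻ x, k x = ∫⁻ t, ∫⁻ x, k (e (t, x)) := by
      intro k hk
      rw [← hmp.lintegral_comp hk, Measure.volume_eq_prod]
      exact lintegral_prod (fun z => k (e z)) (hk.comp e.measurable).aemeasurable
    rw [hfub hf, hfub hg, hfub hh]
    refine prekopa_leindler_real ha hb hab (hf.comp e.measurable).lintegral_prod_right'
      (hg.comp e.measurable).lintegral_prod_right' (hh.comp e.measurable).lintegral_prod_right'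
      fun s t => ?_
    refine ih (hf.comp (e.measurable.comp measurable_prodMk_left))
      (hg.comp (e.measurable.comp measurable_prodMk_left))
      (hh.comp (e.measurable.comp measurable_prodMk_left)) fun x y => ?_
    refine (hfgh _ _).trans (le_of_eq ?_)
    congr 1
    ext i
    refine Fin.cases ?_ (fun j => ?_) i <;> simp [he]

/-- The multiplicative Brunn–Minkowski inequality. -/
theorem brunn_minkowski_mul {d : ℕ} {a b : ℝ} (ha : 0 < a) (hb : 0 < b) (hab : a + b = 1)
    {A B C : Set (EuclideanSpace ℝ (Fin d))} (hA : MeasurableSet A) (hB : MeasurableSet B)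
    (hC : MeasurableSet C) (hABC : ∀ x ∈ A, ∀ y ∈ B, a • x + b • y ∈ C) :
    volume A ^ a * volume B ^ b ≤ volume C := by
  have hmp := PiLp.volume_preserving_toLp (Fin d)
  rw [← hmp.measure_preimage hA.nullMeasurableSet, ← hmp.measure_preimage hB.nullMeasurableSet,
    ← hmp.measure_preimage hC.nullMeasurableSet, ← lintegral_indicator_one (hmp.measurable hA),
    ← lintegral_indicator_one (hmp.measurable hB), ← lintegral_indicator_one (hmp.measurable hC)]
  refine prekopa_leindler_pi ha hb hab d (measurable_one.indicator (hmp.measurable hA))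
    (measurable_one.indicator (hmp.measurable hB)) (measurable_one.indicator (hmp.measurable hC))
    fun x y => ?_
  by_cases hx : WithLp.toLp 2 x ∈ A
  · by_cases hy : WithLp.toLp 2 y ∈ B
    · have := hABC _ hx _ hy
      simp [Set.indicator, hx, hy, this]
    · simp [Set.indicator, hy, hb]
  · simp [Set.indicator, hx, ha]

/-- A positive log-concave function with a positive lower bound near `0` lies below an exponential
which is tangent to it at `0`. -/
theorem exists_le_mul_exp_of_logconcave {E : Type*} [NormedAddCommGroup E] [NormedSpace ℝ E]
    {f : E → ℝ} (hf : ∀ x, 0 ≤ f x) {r m : ℝ} (hr : 0 < r) (hm : 0 < m)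
    (hball : ∀ x ∈ Metric.ball (0 : E) r, m ≤ f x)
    (hlc : ∀ x y : E, ∀ a b : ℝ, 0 < a → 0 < b → a + b = 1 →
      f x ^ a * f y ^ b ≤ f (a • x + b • y)) :
    ∃ φ : StrongDual ℝ E, ∀ x, f x ≤ f 0 * Real.exp (φ x) := by
  set H : Set (E × ℝ) := {p | 0 < f p.1 ∧ p.2 ≤ Real.log (f p.1)} with hH
  have hconv : Convex ℝ H := by
    rw [convex_iff_forall_pos]
    rintro ⟨x, s⟩ ⟨hx, hs⟩ ⟨y, t⟩ ⟨hy, ht⟩ a b ha hb hab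
    have h1 := hlc x y a b ha hb hab
    have h2 : 0 < f x ^ a * f y ^ b := by
      have := Real.rpow_pos_of_pos hx a
      have := Real.rpow_pos_of_pos hy b
      positivity
    refine ⟨h2.trans_le h1, ?_⟩
    have h3 := Real.log_le_log h2 h1
    rw [Real.log_mul (Real.rpow_pos_of_pos hx a).ne' (Real.rpow_pos_of_pos hy b).ne',
      Real.log_rpow hx, Real.log_rpow hy] at h3
    refine le_trans ?_ h3
    simp only at hs ht
    simp only [Prod.smul_mk, Prod.mk_add_mk, smul_eq_mul]
    gcongr
  have hsub : Metric.ball (0 : E) r ×ˢ Set.Iio (Real.log m) ⊆ H := by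
    rintro ⟨x, s⟩ ⟨hx, hs⟩
    have h1 := hball x hx
    exact ⟨hm.trans_le h1, (le_of_lt hs).trans (Real.log_le_log hm h1)⟩
  have hint : (interior H).Nonempty := by
    refine ⟨(0, Real.log m - 1), ?_⟩
    refine interior_maximal hsub (Metric.isOpen_ball.prod isOpen_Iio) ⟨?_, ?_⟩
    · simpa using hr
    · simp
  have hf0 : 0 < f 0 := hm.trans_le (hball 0 (by simpa using hr))
  have hnot : ((0 : E), Real.log (f 0)) ∉ interior H := by
    intro hmem
    have hc : Filter.Tendsto (fun ε : ℝ => ((0 : E), Real.log (f 0) + ε)) (nhds 0)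
        (nhds ((0 : E), Real.log (f 0))) := by
      have : Continuous fun ε : ℝ => ((0 : E), Real.log (f 0) + ε) := by fun_prop
      simpa using this.tendsto 0
    have hev := hc.eventually (mem_interior_iff_mem_nhds.1 hmem)
    obtain ⟨δ, hδ, hδ'⟩ := Metric.eventually_nhds_iff.1 hev
    have := (hδ' (y := δ / 2) (by
      rw [Real.dist_eq, sub_zero, abs_of_pos (by positivity)]; linarith)).2
    simp only at this
    linarith
  obtain ⟨ℓ, hℓ0, hℓ⟩ := geometric_hahn_banach_of_nonempty_interior_point hconv hnot hint
  set c := ℓ (0, 1) with hc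
  set φ : StrongDual ℝ E := ℓ.comp (ContinuousLinearMap.inl ℝ E ℝ) with hφ
  have hsplit : ∀ x s, ℓ (x, s) = φ x + s * c := by
    intro x s
    have : ((x, s) : E × ℝ) = (x, 0) + s • (0, 1) := by simp
    rw [this, map_add, map_smul]
    simp [hφ, hc]
  have hineq : ∀ x s, 0 < f x → s ≤ Real.log (f x) → φ x + s * c ≤ Real.log (f 0) * c := by
    intro x s hx hs
    have := hℓ (x, s) ⟨hx, hs⟩
    rw [hsplit, hsplit, map_zero, zero_add] at this
    exact this
  have hc0 : 0 ≤ c := by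
    have := hineq 0 (Real.log (f 0) - 1) hf0 (by linarith)
    rw [map_zero] at this
    nlinarith
  have hcpos : 0 < c := by
    refine lt_of_le_of_ne hc0 fun hc' => hℓ0 ?_
    rw [← hc'] at hineq hsplit
    have hφ0 : ∀ x, φ x ≤ 0 := by
      intro x
      have hn : 0 < ‖x‖ + 1 := by positivity
      set t := r / (‖x‖ + 1) with ht
      have htpos : 0 < t := div_pos hr hn
      have hmem : t • x ∈ Metric.ball (0 : E) r := by
        rw [mem_ball_zero_iff, norm_smul, Real.norm_of_nonneg htpos.le, ht, div_mul_eq_mul_div,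
          div_lt_iff₀ hn]
        nlinarith
      have := hineq (t • x) _ (hm.trans_le (hball _ hmem)) le_rfl
      rw [map_smul, smul_eq_mul, mul_zero, mul_zero, add_zero] at this
      by_contra hx
      exact absurd this (not_le.2 (mul_pos htpos (not_le.1 hx)))
    ext x
    · have h1 := hφ0 x
      have h2 := hφ0 (-x)
      rw [map_neg] at h2
      have : ℓ (x, 0) = φ x := by simp [hsplit]
      simp only [ContinuousLinearMap.comp_apply, ContinuousLinearMap.inl_apply, this]
      simp
      linarith
    · simpa using hc'.symm
  refine ⟨-(c⁻¹ • φ), fun x => ?_⟩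
  rcases (hf x).eq_or_lt with hx | hx
  · rw [← hx]; positivity
  · have h1 := hineq x _ hx le_rfl
    have h2 : Real.log (f x) ≤ Real.log (f 0) + -(c⁻¹ * φ x) := by
      have : c⁻¹ * φ x * c = φ x := by field_simp
      refine le_of_mul_le_mul_right ?_ hcpos
      linarith
    calc f x = Real.exp (Real.log (f x)) := (Real.exp_log hx).symm
      _ ≤ Real.exp (Real.log (f 0) + -(c⁻¹ * φ x)) := Real.exp_le_exp.2 h2
      _ = _ := by rw [Real.exp_add, Real.exp_log hf0]; simp

/-- The overlaps `K ∩ (w - K)` of a compact convex set containing `0` in its interior are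
dominated by an exponential which is tangent at `w = 0`. -/
theorem exists_overlap_le {d : ℕ} {K : Set (EuclideanSpace ℝ (Fin d))} (hK : IsCompact K)
    (hconv : Convex ℝ K) (h0 : (0 : EuclideanSpace ℝ (Fin d)) ∈ interior K) :
    ∃ φ : StrongDual ℝ (EuclideanSpace ℝ (Fin d)), ∀ w,
      volume {x | x ∈ K ∧ w - x ∈ K} ≤ volume (K ∩ -K) * ENNReal.ofReal (Real.exp (φ w)) := by
  set S : EuclideanSpace ℝ (Fin d) → Set (EuclideanSpace ℝ (Fin d)) :=
    fun w => {x | x ∈ K ∧ w - x ∈ K} with hS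
  have hmeas : ∀ w, MeasurableSet (S w) := fun w =>
    hK.measurableSet.inter (hK.measurableSet.preimage (by fun_prop))
  have hfin : ∀ w, volume (S w) ≠ ⊤ := fun w =>
    ne_top_of_le_ne_top hK.measure_lt_top.ne (measure_mono fun x hx => hx.1)
  obtain ⟨ε, hε, hεK⟩ := Metric.mem_nhds_iff.1 (mem_interior_iff_mem_nhds.1 h0)
  obtain ⟨φ, hφ⟩ := exists_le_mul_exp_of_logconcave (f := fun w => (volume (S w)).toReal)
    (fun _ => ENNReal.toReal_nonneg) (r := ε / 2)
    (m := (volume (Metric.ball (0 : EuclideanSpace ℝ (Fin d)) (ε / 2))).toReal) (by positivity)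
    (ENNReal.toReal_pos (Metric.measure_ball_pos _ _ (by positivity)).ne'
      Metric.isBounded_ball.measure_lt_top.ne)
    (by
      intro w hw
      refine ENNReal.toReal_mono (hfin w) (measure_mono fun x hx => ⟨hεK ?_, hεK ?_⟩)
      · rw [mem_ball_zero_iff] at hx ⊢
        linarith
      · rw [mem_ball_zero_iff] at hx hw ⊢
        linarith [norm_sub_le w x])
    (by
      intro u v a b ha hb hab
      simp only [ENNReal.toReal_rpow, ← ENNReal.toReal_mul]
      refine ENNReal.toReal_mono (hfin _) (brunn_minkowski_mul ha hb hab (hmeas u) (hmeas v)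
        (hmeas _) ?_)
      rintro x ⟨hx, hx'⟩ y ⟨hy, hy'⟩
      refine ⟨hconv hx hy ha.le hb.le hab, ?_⟩
      have := hconv hx' hy' ha.le hb.le hab
      convert this using 1
      module)
  refine ⟨φ, fun w => ?_⟩
  have hS0 : S 0 = K ∩ -K := by
    ext x
    simp [hS]
  have := ENNReal.ofReal_le_ofReal (hφ w)
  rwa [ENNReal.ofReal_mul ENNReal.toReal_nonneg, ENNReal.ofReal_toReal (hfin _),
    ENNReal.ofReal_toReal (hfin _), hS0] at this

/-- The law of `(X + Y) / 2` for independent `X` and `Y` of law `ν`. -/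
noncomputable def halfAverage {d : ℕ} (ν : Measure (EuclideanSpace ℝ (Fin d))) :
    Measure (EuclideanSpace ℝ (Fin d)) :=
  (ν.prod ν).map fun p => (2⁻¹ : ℝ) • (p.1 + p.2)

section HalfAverage

variable {d : ℕ} {ν : Measure (EuclideanSpace ℝ (Fin d))} {K : Set (EuclideanSpace ℝ (Fin d))}

theorem measurable_halfSum : Measurable
    fun p : EuclideanSpace ℝ (Fin d) × EuclideanSpace ℝ (Fin d) => (2⁻¹ : ℝ) • (p.1 + p.2) := by
  fun_prop

theorem isProbabilityMeasure_halfAverage [IsProbabilityMeasure ν] :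
    IsProbabilityMeasure (halfAverage ν) :=
  Measure.isProbabilityMeasure_map measurable_halfSum.aemeasurable

theorem ae_mem_halfAverage [IsProbabilityMeasure ν] (hK : MeasurableSet K) (hconv : Convex ℝ K)
    (hν : ∀ᵐ x ∂ν, x ∈ K) : ∀ᵐ x ∂halfAverage ν, x ∈ K := by
  refine (ae_map_iff (p := fun x => x ∈ K) measurable_halfSum.aemeasurable hK).2 ?_
  filter_upwards [Measure.quasiMeasurePreserving_fst.ae hν,
    Measure.quasiMeasurePreserving_snd.ae hν] with p h1 h2
  rw [smul_add]
  exact hconv h1 h2 (by norm_num) (by norm_num) (by norm_num)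

theorem integrable_of_continuous_of_ae_mem [IsFiniteMeasure ν] (hK : IsCompact K)
    (hν : ∀ᵐ x ∂ν, x ∈ K) {g : EuclideanSpace ℝ (Fin d) → ℝ} (hg : Continuous g) :
    Integrable g ν := by
  obtain ⟨C, hC⟩ := hK.exists_bound_of_continuousOn hg.continuousOn
  refine Integrable.of_bound hg.aestronglyMeasurable C ?_
  filter_upwards [hν] with x hx using hC x hx

theorem integral_halfAverage {g : EuclideanSpace ℝ (Fin d) → ℝ} (hg : Continuous g) :
    ∫ z, g z ∂halfAverage ν = ∫ p, g ((2⁻¹ : ℝ) • (p.1 + p.2)) ∂ν.prod ν :=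
  integral_map measurable_halfSum.aemeasurable hg.aestronglyMeasurable

theorem integral_dual_halfAverage [IsProbabilityMeasure ν] (hK : IsCompact K)
    (hν : ∀ᵐ x ∂ν, x ∈ K) (β : StrongDual ℝ (EuclideanSpace ℝ (Fin d)))
    (hβ : ∫ x, β x ∂ν = 0) : ∫ x, β x ∂halfAverage ν = 0 := by
  have hint : Integrable (fun x => β x) ν := integrable_of_continuous_of_ae_mem hK hν β.continuous
  rw [integral_halfAverage β.continuous]
  simp only [map_smul, map_add, smul_eq_mul]
  rw [integral_const_mul, integral_add (hint.comp_fst ν) (hint.comp_snd ν),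
    integral_fun_fst (fun x => β x), integral_fun_snd (fun x => β x)]
  simp [hβ]

theorem integral_dual_sq_halfAverage [IsProbabilityMeasure ν] (hK : IsCompact K)
    (hν : ∀ᵐ x ∂ν, x ∈ K) (β : StrongDual ℝ (EuclideanSpace ℝ (Fin d)))
    (hβ : ∫ x, β x ∂ν = 0) :
    ∫ x, (β x) ^ 2 ∂halfAverage ν = 2⁻¹ * ∫ x, (β x) ^ 2 ∂ν := by
  have hint : Integrable (fun x => β x) ν := integrable_of_continuous_of_ae_mem hK hν β.continuous
  have hint2 : Integrable (fun x => (β x) ^ 2) ν :=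
    integrable_of_continuous_of_ae_mem hK hν (β.continuous.pow 2)
  rw [integral_halfAverage (g := fun x => (β x) ^ 2) (β.continuous.pow 2)]
  have hexp : ∀ p : EuclideanSpace ℝ (Fin d) × EuclideanSpace ℝ (Fin d),
      (β ((2⁻¹ : ℝ) • (p.1 + p.2))) ^ 2 =
        4⁻¹ * ((β p.1) ^ 2 + (β p.2) ^ 2) + 2⁻¹ * (β p.1 * β p.2) := by
    intro p
    simp only [map_smul, map_add, smul_eq_mul]
    ring
  simp only [hexp]
  rw [integral_add, integral_const_mul, integral_const_mul,
    integral_add (hint2.comp_fst ν) (hint2.comp_snd ν), integral_fun_fst (fun x => (β x) ^ 2),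
    integral_fun_snd (fun x => (β x) ^ 2),
    integral_prod_mul (fun x => β x) (fun x => β x), hβ]
  · simp
    ring
  · exact ((hint2.comp_fst ν).add (hint2.comp_snd ν)).const_mul _
  · exact (hint.mul_prod hint).const_mul _

/-- If overlaps of `K` are dominated by an exponential, then exponential domination of a law on `K`
with respect to Lebesgue measure is inherited by `halfAverage`. -/
theorem lintegral_halfAverage_le [IsProbabilityMeasure ν] (hK : MeasurableSet K)
    (hconv : Convex ℝ K) {φ ψ : StrongDual ℝ (EuclideanSpace ℝ (Fin d))} {C D : ENNReal}
    (hφ : ∀ w, volume {x | x ∈ K ∧ w - x ∈ K} ≤ D * ENNReal.ofReal (Real.exp (φ w)))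
    (hν : ∀ g : EuclideanSpace ℝ (Fin d) → ENNReal, Measurable g →
      ∫⁻ x, g x ∂ν ≤ C * ∫⁻ x in K, g x * ENNReal.ofReal (Real.exp (ψ x)))
    (g : EuclideanSpace ℝ (Fin d) → ENNReal) (hg : Measurable g) :
    ∫⁻ x, g x ∂halfAverage ν ≤ C ^ 2 * D * 2 ^ d *
      ∫⁻ x in K, g x * ENNReal.ofReal (Real.exp (((2 : ℝ) • (ψ + φ)) x)) := by
  set h : EuclideanSpace ℝ (Fin d) → ENNReal :=
    K.indicator fun x => ENNReal.ofReal (Real.exp (ψ x)) with hh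
  have hexpm : Measurable fun x => ENNReal.ofReal (Real.exp (ψ x)) := by fun_prop
  have hhm : Measurable h := hexpm.indicator hK
  have hν' : ∀ g : EuclideanSpace ℝ (Fin d) → ENNReal, Measurable g →
      ∫⁻ x, g x ∂ν ≤ C * ∫⁻ x, g x * h x := by
    intro g hg
    refine (hν g hg).trans_eq ?_
    rw [← lintegral_indicator hK]
    congr 2
    ext x
    by_cases hx : x ∈ K <;> simp [hh, hx]
  have hGm : Measurable fun p : EuclideanSpace ℝ (Fin d) × EuclideanSpace ℝ (Fin d) =>
      g ((2⁻¹ : ℝ) • (p.1 + p.2)) := hg.comp measurable_halfSum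
  have hHm : Measurable fun x => ∫⁻ y, g ((2⁻¹ : ℝ) • (x + y)) * h y :=
    Measurable.lintegral_prod_right' (hGm.mul (hhm.comp measurable_snd))
  have hinner : ∀ w, ∫⁻ x, g ((2⁻¹ : ℝ) • w) * h (w - x) * h x ≤
      D * (K.indicator (fun z => g z * ENNReal.ofReal (Real.exp (((2 : ℝ) • (ψ + φ)) z)))
        ((2⁻¹ : ℝ) • w)) := by
    intro w
    have hS : MeasurableSet {x | x ∈ K ∧ w - x ∈ K} :=
      hK.inter ((measurable_const.sub measurable_id) hK)
    have heq : ∀ x, g ((2⁻¹ : ℝ) • w) * h (w - x) * h x = {x | x ∈ K ∧ w - x ∈ K}.indicator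
        (fun _ => g ((2⁻¹ : ℝ) • w) * ENNReal.ofReal (Real.exp (ψ w))) x := by
      intro x
      by_cases h1 : x ∈ K <;> by_cases h2 : w - x ∈ K <;> simp [hh, h1, h2]
      rw [mul_assoc, ← ENNReal.ofReal_mul (Real.exp_nonneg _), ← Real.exp_add, sub_add_cancel]
    simp only [heq]
    rw [lintegral_indicator_const hS]
    by_cases hw : (2⁻¹ : ℝ) • w ∈ K
    · rw [Set.indicator_of_mem hw]
      have hval : ((2 : ℝ) • (ψ + φ)) ((2⁻¹ : ℝ) • w) = ψ w + φ w := by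
        simp
        ring
      rw [hval, Real.exp_add, ENNReal.ofReal_mul (Real.exp_nonneg _)]
      calc _ ≤ g ((2⁻¹ : ℝ) • w) * ENNReal.ofReal (Real.exp (ψ w)) *
            (D * ENNReal.ofReal (Real.exp (φ w))) := by gcongr; exact hφ w
        _ = _ := by ring
    · have hemp : {x | x ∈ K ∧ w - x ∈ K} = ∅ := by
        refine Set.eq_empty_of_forall_notMem fun x hx => hw ?_
        have := hconv hx.1 hx.2 (by norm_num : (0 : ℝ) ≤ 2⁻¹) (by norm_num : (0 : ℝ) ≤ 2⁻¹)
          (by norm_num)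
        rwa [← smul_add, add_sub_cancel] at this
      simp [hemp]
  have hscale : ∀ F : EuclideanSpace ℝ (Fin d) → ENNReal, Measurable F →
      ∫⁻ w, F ((2⁻¹ : ℝ) • w) = 2 ^ d * ∫⁻ z, F z := by
    intro F hF
    have hm : Measurable fun w : EuclideanSpace ℝ (Fin d) => (2⁻¹ : ℝ) • w := by fun_prop
    rw [← lintegral_map hF hm,
      Measure.map_addHaar_smul volume (by norm_num : (2⁻¹ : ℝ) ≠ 0), lintegral_smul_measure]
    simp [abs_of_pos, ENNReal.ofReal_pow]
  calc ∫⁻ x, g x ∂halfAverage ν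
      = ∫⁻ x, ∫⁻ y, g ((2⁻¹ : ℝ) • (x + y)) ∂ν ∂ν := by
        rw [halfAverage, lintegral_map hg measurable_halfSum, lintegral_prod _ hGm.aemeasurable]
    _ ≤ ∫⁻ x, C * ∫⁻ y, g ((2⁻¹ : ℝ) • (x + y)) * h y ∂volume ∂ν :=
        lintegral_mono fun x => hν' _ (hGm.comp measurable_prodMk_left)
    _ = C * ∫⁻ x, ∫⁻ y, g ((2⁻¹ : ℝ) • (x + y)) * h y ∂volume ∂ν := lintegral_const_mul _ hHm
    _ ≤ C * (C * ∫⁻ x, (∫⁻ y, g ((2⁻¹ : ℝ) • (x + y)) * h y) * h x) := by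
        gcongr
        exact hν' _ hHm
    _ = C * (C * ∫⁻ x, ∫⁻ w, g ((2⁻¹ : ℝ) • w) * h (w - x) * h x) := by
        congr 3
        ext x
        rw [← lintegral_mul_const _ (by fun_prop),
          ← lintegral_sub_right_eq_self
            (fun y => g ((2⁻¹ : ℝ) • (x + y)) * h y * h x) x]
        simp
    _ = C * (C * ∫⁻ w, ∫⁻ x, g ((2⁻¹ : ℝ) • w) * h (w - x) * h x) := by
        rw [lintegral_lintegral_swap]
        fun_prop
    _ ≤ C * (C * ∫⁻ w, D * (K.indicator
          (fun z => g z * ENNReal.ofReal (Real.exp (((2 : ℝ) • (ψ + φ)) z)))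
            ((2⁻¹ : ℝ) • w))) := by
        gcongr with w
        exact hinner w
    _ = _ := by
        rw [hscale (fun z => D * K.indicator
            (fun z => g z * ENNReal.ofReal (Real.exp (((2 : ℝ) • (ψ + φ)) z))) z)
            (((by fun_prop : Measurable fun z =>
              g z * ENNReal.ofReal (Real.exp (((2 : ℝ) • (ψ + φ)) z))).indicator hK).const_mul D),
          lintegral_const_mul _ ((by fun_prop : Measurable fun z =>
              g z * ENNReal.ofReal (Real.exp (((2 : ℝ) • (ψ + φ)) z))).indicator hK),
          lintegral_indicator hK]
        ring

end HalfAverage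

section Iteration

variable {d : ℕ} {ν : Measure (EuclideanSpace ℝ (Fin d))} {K : Set (EuclideanSpace ℝ (Fin d))}

/-- The moment and domination properties of the law of the average of `2 ^ k` independent copies
of a centred random point of a convex set `K`. -/
theorem iterate_halfAverage_properties [IsProbabilityMeasure ν] (hK : IsCompact K)
    (hconv : Convex ℝ K) (hmem : ∀ᵐ x ∂ν, x ∈ K)
    (hmean : ∀ β : StrongDual ℝ (EuclideanSpace ℝ (Fin d)), ∫ x, β x ∂ν = 0)
    {φ : StrongDual ℝ (EuclideanSpace ℝ (Fin d))} {C D : ENNReal}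
    (hφ : ∀ w, volume {x | x ∈ K ∧ w - x ∈ K} ≤ D * ENNReal.ofReal (Real.exp (φ w)))
    (hν : ∀ g : EuclideanSpace ℝ (Fin d) → ENNReal, Measurable g →
      ∫⁻ x, g x ∂ν ≤ C * ∫⁻ x in K, g x) (k : ℕ) :
    IsProbabilityMeasure (halfAverage^[k] ν) ∧ (∀ᵐ x ∂halfAverage^[k] ν, x ∈ K) ∧
      (∀ β : StrongDual ℝ (EuclideanSpace ℝ (Fin d)), ∫ x, β x ∂halfAverage^[k] ν = 0) ∧
      (∀ β : StrongDual ℝ (EuclideanSpace ℝ (Fin d)),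
        ∫ x, (β x) ^ 2 ∂halfAverage^[k] ν = (2 ^ k)⁻¹ * ∫ x, (β x) ^ 2 ∂ν) ∧
      ∃ ψ : StrongDual ℝ (EuclideanSpace ℝ (Fin d)),
        ∀ g : EuclideanSpace ℝ (Fin d) → ENNReal, Measurable g →
          ∫⁻ x, g x ∂halfAverage^[k] ν ≤ C * (C * D * 2 ^ d) ^ (2 ^ k - 1) *
            ∫⁻ x in K, g x * ENNReal.ofReal (Real.exp (ψ x)) := by
  induction k with
  | zero => exact ⟨‹_›, hmem, hmean, by simp, 0, fun g hg => by simpa using hν g hg⟩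
  | succ k ih =>
    obtain ⟨hprob, hmemk, hmeank, hsq, ψ, hψ⟩ := ih
    rw [Function.iterate_succ_apply']
    refine ⟨isProbabilityMeasure_halfAverage,
      ae_mem_halfAverage hK.measurableSet hconv hmemk,
      fun β => integral_dual_halfAverage hK hmemk β (hmeank β), fun β => ?_,
      (2 : ℝ) • (ψ + φ), fun g hg => ?_⟩
    · rw [integral_dual_sq_halfAverage hK hmemk β (hmeank β), hsq β, pow_succ, mul_inv]
      ring
    · refine (lintegral_halfAverage_le hK.measurableSet hconv hφ hψ g hg).trans_eq ?_
      have hexp : 2 ^ (k + 1) - 1 = 2 * (2 ^ k - 1) + 1 := by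
        have := Nat.one_le_two_pow (n := k)
        rw [pow_succ]
        omega
      rw [hexp]
      congr 1
      ring

end Iteration

section Gaussian

variable {d : ℕ} {ν : Measure (EuclideanSpace ℝ (Fin d))} {K : Set (EuclideanSpace ℝ (Fin d))}

theorem lintegral_exp_neg_mul_norm_sq_linearMap
    {T : EuclideanSpace ℝ (Fin d) →ₗ[ℝ] EuclideanSpace ℝ (Fin d)} (hT : LinearMap.det T ≠ 0)
    {t : ℝ} (ht : 0 < t) :
    ∫⁻ x, ENNReal.ofReal (Real.exp (-t * ‖T x‖ ^ 2)) =
      ENNReal.ofReal (|LinearMap.det T|⁻¹ * (Real.pi / t) ^ ((d : ℝ) / 2)) := by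
  have hTm : Measurable T := (LinearMap.continuous_of_finiteDimensional T).measurable
  have hgauss := GaussianFourier.integral_rexp_neg_mul_sq_norm
    (V := EuclideanSpace ℝ (Fin d)) ht
  rw [finrank_euclideanSpace_fin] at hgauss
  have hpos : 0 < (Real.pi / t) ^ ((d : ℝ) / 2) := by positivity
  have hintg : Integrable fun v : EuclideanSpace ℝ (Fin d) => Real.exp (-t * ‖v‖ ^ 2) := by
    by_contra hcon
    rw [integral_undef hcon] at hgauss
    exact hpos.ne hgauss
  rw [← lintegral_map (μ := volume) (f := fun v : EuclideanSpace ℝ (Fin d) =>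
      ENNReal.ofReal (Real.exp (-t * ‖v‖ ^ 2))) (by fun_prop) hTm,
    Measure.map_linearMap_addHaar_eq_smul_addHaar volume hT, lintegral_smul_measure,
    ← ofReal_integral_eq_lintegral_ofReal hintg (.of_forall fun _ => Real.exp_nonneg _), hgauss,
    smul_eq_mul, ← ENNReal.ofReal_mul (abs_nonneg _), abs_inv]

/-- A centred law dominated by an exponential weight on `K` cannot be too concentrated:
comparison with a Gaussian weight. -/
theorem ofReal_exp_neg_le_of_dominated [IsProbabilityMeasure ν] (hK : IsCompact K)
    (hmem : ∀ᵐ x ∂ν, x ∈ K) {ψ : StrongDual ℝ (EuclideanSpace ℝ (Fin d))}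
    (hmean : ∫ x, ψ x ∂ν = 0) {C : ENNReal}
    (hν : ∀ g : EuclideanSpace ℝ (Fin d) → ENNReal, Measurable g →
      ∫⁻ x, g x ∂ν ≤ C * ∫⁻ x in K, g x * ENNReal.ofReal (Real.exp (ψ x)))
    {T : EuclideanSpace ℝ (Fin d) →ₗ[ℝ] EuclideanSpace ℝ (Fin d)} (hT : LinearMap.det T ≠ 0)
    {t : ℝ} (ht : 0 < t) :
    ENNReal.ofReal (Real.exp (-t * ∫ x, ‖T x‖ ^ 2 ∂ν)) ≤
      C * ENNReal.ofReal (|LinearMap.det T|⁻¹ * (Real.pi / t) ^ ((d : ℝ) / 2)) := by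
  have hTc : Continuous T := LinearMap.continuous_of_finiteDimensional T
  have hintq : Integrable (fun x => ‖T x‖ ^ 2) ν :=
    integrable_of_continuous_of_ae_mem hK hmem (by fun_prop)
  have hintψ : Integrable (fun x => ψ x) ν :=
    integrable_of_continuous_of_ae_mem hK hmem ψ.continuous
  have hexpc : Continuous fun x => Real.exp (-t * ‖T x‖ ^ 2 - ψ x) := by fun_prop
  have hintexp : Integrable (fun x => Real.exp (-t * ‖T x‖ ^ 2 - ψ x)) ν :=
    integrable_of_continuous_of_ae_mem hK hmem hexpc
  have hjensen : Real.exp (∫ x, (-t * ‖T x‖ ^ 2 - ψ x) ∂ν) ≤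
      ∫ x, Real.exp (-t * ‖T x‖ ^ 2 - ψ x) ∂ν :=
    convexOn_exp.map_integral_le Real.continuous_exp.continuousOn isClosed_univ
      (.of_forall fun _ => Set.mem_univ _) ((hintq.const_mul _).sub hintψ) hintexp
  rw [integral_sub (hintq.const_mul _) hintψ, integral_const_mul, hmean, sub_zero] at hjensen
  calc ENNReal.ofReal (Real.exp (-t * ∫ x, ‖T x‖ ^ 2 ∂ν))
      ≤ ENNReal.ofReal (∫ x, Real.exp (-t * ‖T x‖ ^ 2 - ψ x) ∂ν) := ENNReal.ofReal_le_ofReal hjensen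
    _ = ∫⁻ x, ENNReal.ofReal (Real.exp (-t * ‖T x‖ ^ 2 - ψ x)) ∂ν :=
        ofReal_integral_eq_lintegral_ofReal hintexp (.of_forall fun _ => Real.exp_nonneg _)
    _ ≤ C * ∫⁻ x in K, ENNReal.ofReal (Real.exp (-t * ‖T x‖ ^ 2 - ψ x)) *
          ENNReal.ofReal (Real.exp (ψ x)) := hν _ hexpc.measurable.ennreal_ofReal
    _ = C * ∫⁻ x in K, ENNReal.ofReal (Real.exp (-t * ‖T x‖ ^ 2)) := by
        simp only [← ENNReal.ofReal_mul (Real.exp_nonneg _), ← Real.exp_add, sub_add_cancel]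
    _ ≤ C * ∫⁻ x, ENNReal.ofReal (Real.exp (-t * ‖T x‖ ^ 2)) := by
        gcongr
        exact Measure.restrict_le_self
    _ = _ := by rw [lintegral_exp_neg_mul_norm_sq_linearMap hT ht]

end Gaussian

/-- A positive definite matrix `S` is whitened by some matrix `A`. -/
theorem Matrix.PosDef.exists_whitening {n : Type*} [Fintype n] [DecidableEq n]
    {S : Matrix n n ℝ} (hS : S.PosDef) :
    ∃ A : Matrix n n ℝ, A.det ≠ 0 ∧ |A.det|⁻¹ = Real.sqrt S.det ∧
      (A * S * A.transpose).trace = Fintype.card n := by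
  open scoped MatrixOrder in
  obtain ⟨A, hA⟩ := CStarAlgebra.nonneg_iff_eq_star_mul_self.1 hS.inv.posSemidef.nonneg
  rw [Matrix.star_eq_conjTranspose, Matrix.conjTranspose_eq_transpose_of_trivial] at hA
  have hSdet := hS.det_pos
  have hdet : A.det ^ 2 = S.det⁻¹ := by
    have := congrArg Matrix.det hA
    rw [Matrix.det_mul, Matrix.det_transpose, Matrix.det_nonsing_inv, Ring.inverse_eq_inv'] at this
    rw [this, sq]
  refine ⟨A, ?_, ?_, ?_⟩
  · rintro h0
    rw [h0] at hdet
    have := inv_pos.2 hSdet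
    linarith
  · rw [← Real.sqrt_sq_eq_abs, hdet, Real.sqrt_inv, inv_inv]
  · rw [Matrix.trace_mul_comm, ← Matrix.mul_assoc, ← hA,
      Matrix.nonsing_inv_mul _ (isUnit_iff_ne_zero.2 hSdet.ne'), Matrix.trace_one]

/-- The dyadic choice of the number of averaged points. -/
theorem exp_le_of_forall_dyadic {d : ℕ} {L R : ℝ} (hd : 1 ≤ d) (hL : 0 < L) (hR : 0 < R)
    (h : ∀ k : ℕ, Real.exp (-((d : ℝ) / 2)) ≤
      R ^ (2 ^ k - 1) * (L ^ d * (2 * Real.pi / 2 ^ k) ^ ((d : ℝ) / 2))) :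
    Real.exp ((d : ℝ) / (2 ^ 16 * L ^ 2)) ≤ R := by
  have hd0 : (1 : ℝ) ≤ d := by exact_mod_cast hd
  have hpi := Real.pi_pos
  have hlog : ∀ k : ℕ, (d : ℝ) / 2 * (k * Real.log 2 - Real.log (2 * Real.pi * L ^ 2) - 1) ≤
      (2 ^ k - 1) * Real.log R := by
    intro k
    have h1 := Real.log_le_log (Real.exp_pos _) (h k)
    have h2k : (0 : ℝ) < 2 ^ k := by positivity
    have hsub : ((2 ^ k - 1 : ℕ) : ℝ) = 2 ^ k - 1 := by
      rw [Nat.cast_sub Nat.one_le_two_pow]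
      simp
    rw [Real.log_exp, Real.log_mul (by positivity) (by positivity),
      Real.log_mul (by positivity) (by positivity), Real.log_pow, Real.log_pow,
      Real.log_rpow (by positivity), Real.log_div (by positivity) (by positivity), Real.log_pow,
      hsub] at h1
    rw [Real.log_mul (by positivity) (by positivity), Real.log_pow]
    push_cast
    linarith
  have h0 := hlog 0
  have hlow : -1 ≤ Real.log (2 * Real.pi * L ^ 2) := by
    simp only [Nat.cast_zero, pow_zero] at h0
    nlinarith
  set y : ℝ := Real.exp 2 * (2 * Real.pi * L ^ 2) with hy
  have hypos : 0 < y := by positivity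
  have hlogy : Real.log y = 2 + Real.log (2 * Real.pi * L ^ 2) := by
    rw [hy, Real.log_mul (by positivity) (by positivity), Real.log_exp]
  have hy1 : 1 ≤ y := by
    rw [← Real.log_nonneg_iff hypos]
    linarith
  obtain ⟨n, hn1, hn2⟩ := exists_nat_pow_near hy1 (one_lt_two : (1 : ℝ) < 2)
  have hlogn : Real.log y < (n + 1 : ℕ) * Real.log 2 := by
    rw [← Real.log_pow]
    exact Real.log_lt_log hypos hn2
  have hmain : (d : ℝ) / 2 ≤ (2 ^ (n + 1) - 1) * Real.log R := by
    refine le_trans ?_ (hlog (n + 1))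
    nlinarith
  have hN : (1 : ℝ) ≤ 2 ^ n := one_le_pow₀ (by norm_num)
  have hlogR : 0 ≤ Real.log R := by
    rw [pow_succ] at hmain
    by_contra hneg
    push Not at hneg
    nlinarith
  have hye : y ≤ 2 ^ 14 * L ^ 2 := by
    have he : Real.exp 2 ≤ 9 := by
      have h3 := Real.exp_one_lt_d9
      have h4 : Real.exp 2 = Real.exp 1 * Real.exp 1 := by rw [← Real.exp_add]; norm_num
      have h5 := Real.exp_pos 1
      rw [h4]
      nlinarith
    have hpi4 := Real.pi_lt_four
    calc y ≤ 9 * (2 * 4 * L ^ 2) := by rw [hy]; gcongr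
      _ ≤ 2 ^ 14 * L ^ 2 := by nlinarith [sq_nonneg L]
  rw [← Real.le_log_iff_exp_le hR, div_le_iff₀ (by positivity)]
  have hNle : (2 : ℝ) ^ (n + 1) ≤ 2 ^ 15 * L ^ 2 := by
    rw [pow_succ]
    linarith
  nlinarith

section Uniform

variable {d : ℕ} {K : Set (EuclideanSpace ℝ (Fin d))}

theorem integral_cond_volume (g : EuclideanSpace ℝ (Fin d) → ℝ) :
    ∫ x, g x ∂ProbabilityTheory.cond volume K = (volume K).toReal⁻¹ * ∫ x in K, g x := by
  rw [ProbabilityTheory.cond, integral_smul_measure, ENNReal.toReal_inv, smul_eq_mul]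

theorem volume_pos_of_interior_nonempty (hint : (interior K).Nonempty) : 0 < volume K :=
  (isOpen_interior.measure_pos volume hint).trans_le (measure_mono interior_subset)

theorem isProbabilityMeasure_cond_volume (hcpt : IsCompact K) (hint : (interior K).Nonempty) :
    IsProbabilityMeasure (ProbabilityTheory.cond volume K) :=
  ProbabilityTheory.cond_isProbabilityMeasure_of_finite
    (volume_pos_of_interior_nonempty hint).ne' hcpt.measure_lt_top.ne

theorem ae_cond_volume_mem (hcpt : IsCompact K) :
    ∀ᵐ x ∂ProbabilityTheory.cond volume K, x ∈ K :=
  ProbabilityTheory.ae_cond_mem hcpt.measurableSet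

theorem integral_dual_cond_volume (hcpt : IsCompact K)
    (β : StrongDual ℝ (EuclideanSpace ℝ (Fin d))) :
    ∫ x, β x ∂ProbabilityTheory.cond volume K = β (centroid K) := by
  rw [integral_cond_volume, centroid, map_smul, smul_eq_mul,
    ← β.integral_comp_comm (φ := fun x => x)
      (continuous_id.continuousOn.integrableOn_compact hcpt)]

/-- A functional vanishing at almost every point of a set with nonempty interior vanishes. -/
theorem dual_eq_zero_of_ae_cond_volume (hcpt : IsCompact K) (hint : (interior K).Nonempty)
    {β : StrongDual ℝ (EuclideanSpace ℝ (Fin d))}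
    (hβ : ∀ᵐ x ∂ProbabilityTheory.cond volume K, β x = 0) : β = 0 := by
  by_contra hne
  have hprob := isProbabilityMeasure_cond_volume hcpt hint
  have hker : LinearMap.ker (β : EuclideanSpace ℝ (Fin d) →ₗ[ℝ] ℝ) ≠ ⊤ := by
    intro h
    refine hne (ContinuousLinearMap.ext fun x => ?_)
    have : x ∈ LinearMap.ker (β : EuclideanSpace ℝ (Fin d) →ₗ[ℝ] ℝ) := h ▸ Submodule.mem_top
    simpa using this
  have hnull : ∀ᵐ x ∂ProbabilityTheory.cond volume K, β x ≠ 0 := by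
    refine (ProbabilityTheory.cond_absolutelyContinuous (μ := volume) (s := K)).ae_le ?_
    have := Measure.addHaar_submodule volume _ hker
    refine ae_iff.2 ?_
    convert this using 2
    ext x
    simp
  obtain ⟨x, hx, hx'⟩ := (hβ.and hnull).exists
  exact hx' hx

theorem zero_mem_interior_of_centroid_eq_zero (hcpt : IsCompact K) (hconv : Convex ℝ K)
    (hint : (interior K).Nonempty) (hcentred : centroid K = 0) : 0 ∈ interior K := by
  by_contra h0
  obtain ⟨β, hβne, hβ⟩ := geometric_hahn_banach_of_nonempty_interior_point hconv h0 hint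
  have hprob := isProbabilityMeasure_cond_volume hcpt hint
  have hzero : ∫ x, -β x ∂ProbabilityTheory.cond volume K = 0 := by
    rw [integral_neg, integral_dual_cond_volume hcpt, hcentred, map_zero, neg_zero]
  rw [integral_eq_zero_iff_of_nonneg_ae] at hzero
  · refine hβne (dual_eq_zero_of_ae_cond_volume hcpt hint ?_)
    filter_upwards [hzero] with x hx
    simpa using hx
  · filter_upwards [ae_cond_volume_mem hcpt] with x hx
    simpa using hβ x hx
  · exact integrable_of_continuous_of_ae_mem hcpt (ae_cond_volume_mem hcpt) β.continuous.neg

theorem covMatrix_apply_of_centroid_eq_zero (hcentred : centroid K = 0) (i j : Fin d) :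
    covMatrix K i j = ∫ x, x i * x j ∂ProbabilityTheory.cond volume K := by
  simp [covMatrix, hcentred, integral_cond_volume]

/-- The functional `x ↦ ∑ i, v i * x i`. -/
noncomputable def dotDual (v : Fin d → ℝ) : StrongDual ℝ (EuclideanSpace ℝ (Fin d)) :=
  ∑ i, v i • EuclideanSpace.proj i

theorem dotDual_apply (v : Fin d → ℝ) (x : EuclideanSpace ℝ (Fin d)) :
    dotDual v x = ∑ i, v i * x i := by
  simp [dotDual]

theorem integral_dotDual_sq (hcpt : IsCompact K) (hint : (interior K).Nonempty)
    (hcentred : centroid K = 0) (v : Fin d → ℝ) :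
    ∫ x, (dotDual v x) ^ 2 ∂ProbabilityTheory.cond volume K =
      ∑ i, ∑ j, v i * covMatrix K i j * v j := by
  have hprob := isProbabilityMeasure_cond_volume hcpt hint
  have hexp : ∀ x : EuclideanSpace ℝ (Fin d),
      (dotDual v x) ^ 2 = ∑ i, ∑ j, v i * v j * (x i * x j) := by
    intro x
    rw [dotDual_apply, sq, Finset.sum_mul_sum]
    exact Finset.sum_congr rfl fun i _ => Finset.sum_congr rfl fun j _ => by ring
  have hcoord : ∀ i j : Fin d, Integrable
      (fun x : EuclideanSpace ℝ (Fin d) => v i * v j * (x i * x j))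
      (ProbabilityTheory.cond volume K) := fun i j =>
    integrable_of_continuous_of_ae_mem hcpt (ae_cond_volume_mem hcpt) (by fun_prop)
  simp only [hexp]
  rw [integral_finsetSum _ fun i _ => integrable_finsetSum _ fun j _ => hcoord i j]
  refine Finset.sum_congr rfl fun i _ => ?_
  rw [integral_finsetSum _ fun j _ => hcoord i j]
  refine Finset.sum_congr rfl fun j _ => ?_
  rw [integral_const_mul, covMatrix_apply_of_centroid_eq_zero hcentred]
  ring

theorem posDef_covMatrix (hcpt : IsCompact K) (hint : (interior K).Nonempty)
    (hcentred : centroid K = 0) : (covMatrix K).PosDef := by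
  have hprob := isProbabilityMeasure_cond_volume hcpt hint
  refine Matrix.PosDef.of_dotProduct_mulVec_pos ?_ fun v hv => ?_
  · ext i j
    simp [covMatrix, mul_comm]
  · have hquad : star v ⬝ᵥ (covMatrix K).mulVec v =
        ∫ x, (dotDual v x) ^ 2 ∂ProbabilityTheory.cond volume K := by
      rw [integral_dotDual_sq hcpt hint hcentred]
      simp only [dotProduct, Matrix.mulVec, Finset.mul_sum, star_trivial, mul_assoc]
    rw [hquad]
    refine lt_of_le_of_ne (integral_nonneg fun x => sq_nonneg _) fun hzero => hv ?_
    rw [eq_comm, integral_eq_zero_iff_of_nonneg (fun x => sq_nonneg _)] at hzero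
    · have hβ : dotDual v = 0 := dual_eq_zero_of_ae_cond_volume hcpt hint <| by
        filter_upwards [hzero] with x hx
        simpa using hx
      ext i
      have := DFunLike.congr_fun hβ (EuclideanSpace.single i 1)
      simpa [dotDual_apply, Pi.single_apply] using this
    · exact integrable_of_continuous_of_ae_mem hcpt (ae_cond_volume_mem hcpt)
        ((dotDual v).continuous.pow 2)

theorem isotropicConstant_pos (hcpt : IsCompact K) (hint : (interior K).Nonempty)
    (hcentred : centroid K = 0) : 0 < isotropicConstant K := by
  have hdet := (posDef_covMatrix hcpt hint hcentred).det_pos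
  have hV := ENNReal.toReal_pos (volume_pos_of_interior_nonempty hint).ne' hcpt.measure_lt_top.ne
  unfold isotropicConstant
  positivity

theorem isotropicConstant_pow (hd : 1 ≤ d) :
    isotropicConstant K ^ d = Real.sqrt (covMatrix K).det / (volume K).toReal :=
  Real.rpow_inv_natCast_pow (by positivity) (by omega)

theorem lintegral_cond_volume (g : EuclideanSpace ℝ (Fin d) → ENNReal) :
    ∫⁻ x, g x ∂ProbabilityTheory.cond volume K = (volume K)⁻¹ * ∫⁻ x in K, g x := by
  rw [ProbabilityTheory.cond, lintegral_smul_measure, smul_eq_mul]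

/-- The comparison between `K ∩ -K` and the isotropic constant obtained by averaging `2 ^ k`
independent random points of `K`. -/
theorem exp_neg_le_overlap_pow_mul (hd : 1 ≤ d) (hcpt : IsCompact K) (hconv : Convex ℝ K)
    (hint : (interior K).Nonempty) (hcentred : centroid K = 0) (k : ℕ) :
    Real.exp (-((d : ℝ) / 2)) ≤
      ((volume (K ∩ -K)).toReal / (volume K).toReal * 2 ^ d) ^ (2 ^ k - 1) *
        (isotropicConstant K ^ d * (2 * Real.pi / 2 ^ k) ^ ((d : ℝ) / 2)) := by
  have hprob := isProbabilityMeasure_cond_volume hcpt hint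
  have hmem := ae_cond_volume_mem hcpt
  have hVpos := volume_pos_of_interior_nonempty hint
  have hVtop := hcpt.measure_lt_top (μ := volume)
  obtain ⟨φ, hφ⟩ := exists_overlap_le hcpt hconv
    (zero_mem_interior_of_centroid_eq_zero hcpt hconv hint hcentred)
  obtain ⟨hprobk, hmemk, hmeank, hsq, ψ, hψ⟩ := iterate_halfAverage_properties hcpt hconv hmem
    (fun β => by rw [integral_dual_cond_volume hcpt, hcentred, map_zero]) hφ
    (fun g _ => (lintegral_cond_volume g).le) k
  obtain ⟨A, hA, hAdet, htrace⟩ := (posDef_covMatrix hcpt hint hcentred).exists_whitening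
  set T := Matrix.toEuclideanLin A with hTdef
  have hTA : LinearMap.det T = A.det := by
    rw [hTdef, Matrix.toEuclideanLin, Matrix.toLpLin_eq_toLin, LinearMap.det_toLin]
  have hnorm : ∀ x, ‖T x‖ ^ 2 = ∑ i, (dotDual (A.row i) x) ^ 2 := by
    intro x
    rw [EuclideanSpace.real_norm_sq_eq]
    refine Finset.sum_congr rfl fun i _ => ?_
    rw [dotDual_apply, hTdef, Matrix.toEuclideanLin, Matrix.toLpLin_apply]
    rfl
  have hsum : ∫ x, ‖T x‖ ^ 2 ∂halfAverage^[k] (ProbabilityTheory.cond volume K) =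
      (2 ^ k)⁻¹ * d := by
    simp only [hnorm]
    rw [integral_finsetSum _ fun i _ => integrable_of_continuous_of_ae_mem hcpt hmemk
      (g := fun x => (dotDual (A.row i) x) ^ 2) ((dotDual (A.row i)).continuous.pow 2)]
    simp only [hsq, integral_dotDual_sq hcpt hint hcentred, ← Finset.mul_sum]
    rw [Fintype.card_fin] at htrace
    rw [← htrace]
    congr 1
    simp only [Matrix.trace, Matrix.diag, Matrix.mul_apply, Matrix.transpose_apply, Finset.sum_mul]
    exact Finset.sum_congr rfl fun i _ => Finset.sum_comm
  have hkey := ofReal_exp_neg_le_of_dominated hcpt hmemk (hmeank ψ) hψ (hTA ▸ hA)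
    (by positivity : (0 : ℝ) < 2 ^ k / 2)
  have hTop : volume (K ∩ -K) ≠ ⊤ := (measure_mono Set.inter_subset_left).trans_lt hVtop |>.ne
  have hreal := ENNReal.toReal_mono (by finiteness) hkey
  rw [ENNReal.toReal_ofReal (Real.exp_nonneg _), hsum, hTA, hAdet] at hreal
  simp only [ENNReal.toReal_mul, ENNReal.toReal_pow, ENNReal.toReal_inv, ENNReal.toReal_ofNat]
    at hreal
  rw [ENNReal.toReal_ofReal (by positivity)] at hreal
  rw [isotropicConstant_pow hd]
  convert hreal using 1
  · congr 1
    field_simp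
  · rw [show Real.pi / (2 ^ k / 2) = 2 * Real.pi / 2 ^ k by field_simp]
    ring

end Uniform

theorem overlap_div_le_kbSym {d : ℕ} {K : Set (EuclideanSpace ℝ (Fin d))} (hcpt : IsCompact K) :
    (volume (K ∩ -K)).toReal / (volume K).toReal ≤ kbSym K := by
  have hbdd : BddAbove (Set.range fun x : EuclideanSpace ℝ (Fin d) =>
      (volume (K ∩ (fun y => x - y) '' K)).toReal / (volume K).toReal) := by
    refine ⟨1, ?_⟩
    rintro _ ⟨x, rfl⟩
    exact div_le_one_of_le₀ (ENNReal.toReal_mono hcpt.measure_lt_top.ne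
      (measure_mono Set.inter_subset_left)) ENNReal.toReal_nonneg
  simpa [kbSym] using le_ciSup hbdd 0

/-- For every convex body `K ⊆ ℝ^d` (`d ≥ 1`) whose centre of mass is the origin,
`vol(K ∩ (-K)) / vol(K) ≥ exp(d / (2^16 L_K^2)) · 2^(-d)`, and in particular the same
lower bound holds for `Δ_KB(K)`. -/
theorem centred_kb_lower_bound {d : ℕ} (hd : 1 ≤ d)
    (K : Set (EuclideanSpace ℝ (Fin d)))
    (hcpt : IsCompact K) (hconv : Convex ℝ K) (hint : (interior K).Nonempty)
    (hcentred : centroid K = 0) :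
    (volume (K ∩ (-K))).toReal / (volume K).toReal ≥
      Real.exp ((d : ℝ) / (2 ^ 16 * (isotropicConstant K) ^ 2)) * ((2 : ℝ) ^ d)⁻¹ ∧
    kbSym K ≥
      Real.exp ((d : ℝ) / (2 ^ 16 * (isotropicConstant K) ^ 2)) * ((2 : ℝ) ^ d)⁻¹ := by
  have hVpos := volume_pos_of_interior_nonempty hint
  have hVreal := ENNReal.toReal_pos hVpos.ne' hcpt.measure_lt_top.ne
  have h0 := zero_mem_interior_of_centroid_eq_zero hcpt hconv hint hcentred
  have hoverlap : 0 < (volume (K ∩ -K)).toReal := by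
    refine ENNReal.toReal_pos (volume_pos_of_interior_nonempty ⟨0, ?_⟩).ne'
      ((measure_mono Set.inter_subset_left).trans_lt hcpt.measure_lt_top).ne
    rw [interior_inter]
    refine ⟨h0, ?_⟩
    rw [mem_interior_iff_mem_nhds] at h0 ⊢
    simpa using neg_mem_nhds_zero _ h0
  have hratio : (volume (K ∩ (-K))).toReal / (volume K).toReal ≥
      Real.exp ((d : ℝ) / (2 ^ 16 * (isotropicConstant K) ^ 2)) * ((2 : ℝ) ^ d)⁻¹ := by
    rw [ge_iff_le, ← div_eq_mul_inv, div_le_iff₀ (by positivity)]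
    exact exp_le_of_forall_dyadic hd (isotropicConstant_pos hcpt hint hcentred) (by positivity)
      (exp_neg_le_overlap_pow_mul hd hcpt hconv hint hcentred)
  exact ⟨hratio, hratio.trans (overlap_div_le_kbSym hcpt)⟩
end

section
/- Let d ≥ 1 and let K ⊂ ℝ^d be a convex body of volume 1 with E[X] = 0 and E[X ⊗ X] = L² · I_d for X uniform on K, and let k ∈ ℕ satisfy 2^15 · L² ≤ 2^k ≤ 2^16 · L². Let f_{S_k} be the density of S_k = 2^{−k} ∑_{i=1}^{2^k} X_i, where X₁, …, X_{2^k} are independent uniformly random points of K. Then the essential supremum of f_{S_k} satisfies ‖f_{S_k}‖_∞ ≥ e^{2d}. -/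
open MeasureTheory Pointwise

open scoped Convolution

/-- A continuous linear functional acts as a derivation on convolutions of integrable functions. -/
theorem mul_convolution_ae_eq {d : ℕ} (l : EuclideanSpace ℝ (Fin d) →L[ℝ] ℝ)
    {f g : EuclideanSpace ℝ (Fin d) → ℝ} (hf : Integrable f) (hg : Integrable g)
    (hlf : Integrable fun x => l x * f x) (hlg : Integrable fun x => l x * g x) :
    (fun x => l x * (f ⋆[ContinuousLinearMap.mul ℝ ℝ, volume] g) x) =ᵐ[volume] fun x =>
      ((fun x => l x * f x) ⋆[ContinuousLinearMap.mul ℝ ℝ, volume] g) x +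
        (f ⋆[ContinuousLinearMap.mul ℝ ℝ, volume] fun x => l x * g x) x := by
  filter_upwards [hlf.ae_convolution_exists (ContinuousLinearMap.mul ℝ ℝ) hg,
    hf.ae_convolution_exists (ContinuousLinearMap.mul ℝ ℝ) hlg] with x h₁ h₂
  simp only [convolution_mul]
  rw [← integral_const_mul]
  refine Eq.trans ?_ (integral_add h₁ h₂)
  congr 1 with t
  simp only [map_sub]
  ring

/-- `f` has total mass `1`, and under the density `f` the functional `l` is centred with second
moment `s`. -/
structure HasCenteredMoments {d : ℕ} (l : EuclideanSpace ℝ (Fin d) →L[ℝ] ℝ)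
    (f : EuclideanSpace ℝ (Fin d) → ℝ) (s : ℝ) : Prop where
  integrable : Integrable f
  integrable_first : Integrable fun x => l x * f x
  integrable_second : Integrable fun x => l x * (l x * f x)
  mass : ∫ x, f x = 1
  first : ∫ x, l x * f x = 0
  second : ∫ x, l x * (l x * f x) = s

/-- Second moments of centred densities add up under convolution. -/
theorem HasCenteredMoments.convolution {d : ℕ} {l : EuclideanSpace ℝ (Fin d) →L[ℝ] ℝ}
    {f g : EuclideanSpace ℝ (Fin d) → ℝ} {s t : ℝ}
    (hf : HasCenteredMoments l f s) (hg : HasCenteredMoments l g t) :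
    HasCenteredMoments l (f ⋆[ContinuousLinearMap.mul ℝ ℝ, volume] g) (s + t) := by
  let B := ContinuousLinearMap.mul ℝ ℝ
  have e₁ := mul_convolution_ae_eq l hf.integrable hg.integrable hf.integrable_first
    hg.integrable_first
  have e₂ := mul_convolution_ae_eq l hf.integrable_first hg.integrable hf.integrable_second
    hg.integrable_first
  have e₃ := mul_convolution_ae_eq l hf.integrable hg.integrable_first hf.integrable_first
    hg.integrable_second
  have i₁₀ := hf.integrable_first.integrable_convolution B hg.integrable
  have i₀₁ := hf.integrable.integrable_convolution B hg.integrable_first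
  have i₂₀ := hf.integrable_second.integrable_convolution B hg.integrable
  have i₁₁ := hf.integrable_first.integrable_convolution B hg.integrable_first
  have i₀₂ := hf.integrable.integrable_convolution B hg.integrable_second
  have e₄ : (fun x => l x * (l x * (f ⋆[B, volume] g) x)) =ᵐ[volume] fun x =>
      (((fun x => l x * (l x * f x)) ⋆[B, volume] g) x +
        ((fun x => l x * f x) ⋆[B, volume] fun x => l x * g x) x) +
      (((fun x => l x * f x) ⋆[B, volume] fun x => l x * g x) x +
        (f ⋆[B, volume] fun x => l x * (l x * g x)) x) := by
    filter_upwards [e₁, e₂, e₃] with x h₁ h₂ h₃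
    rw [h₁, mul_add, h₂, h₃]
  refine ⟨hf.integrable.integrable_convolution B hg.integrable, (i₁₀.add i₀₁).congr e₁.symm,
    ((i₂₀.add i₁₁).add (i₁₁.add i₀₂)).congr e₄.symm, ?_, ?_, ?_⟩
  · rw [integral_convolution _ hf.integrable hg.integrable]
    simp [hf.mass, hg.mass]
  · rw [integral_congr_ae e₁, integral_add i₁₀ i₀₁,
      integral_convolution _ hf.integrable_first hg.integrable,
      integral_convolution _ hf.integrable hg.integrable_first]
    simp [hf.first, hg.first]
  · rw [integral_congr_ae e₄]
    refine (integral_add (i₂₀.add i₁₁) (i₁₁.add i₀₂)).trans ?_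
    rw [integral_add' i₂₀ i₁₁, integral_add' i₁₁ i₀₂,
      integral_convolution _ hf.integrable_second hg.integrable,
      integral_convolution _ hf.integrable_first hg.integrable_first,
      integral_convolution _ hf.integrable hg.integrable_second]
    simp [B, hf.first, hg.first, hf.mass, hg.mass, hf.second, hg.second]

theorem HasCenteredMoments.convIter {d : ℕ} {l : EuclideanSpace ℝ (Fin d) →L[ℝ] ℝ}
    {f : EuclideanSpace ℝ (Fin d) → ℝ} {s : ℝ} (hf : HasCenteredMoments l f s) (n : ℕ) :
    HasCenteredMoments l (convIter f n) ((n + 1) * s) := by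
  induction n with
  | zero => simpa [_root_.convIter] using hf
  | succ n ih =>
    have h := hf.convolution ih
    rw [show s + ((n : ℝ) + 1) * s = ((n + 1 : ℕ) + 1) * s by push_cast; ring] at h
    exact h

/-- Rescaling the density of `n X` to that of `X`. -/
theorem HasCenteredMoments.rescale {d : ℕ} {l : EuclideanSpace ℝ (Fin d) →L[ℝ] ℝ}
    {f : EuclideanSpace ℝ (Fin d) → ℝ} {s r : ℝ} (hf : HasCenteredMoments l f s) (hr : 0 < r) :
    HasCenteredMoments l (fun z => r ^ d * f (r • z)) (s / r ^ 2) := by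
  have hr0 := hr.ne'
  have hint (h : EuclideanSpace ℝ (Fin d) → ℝ) :
      ∫ x, h (r • x) = (r ^ d)⁻¹ * ∫ x, h x := by
    rw [Measure.integral_comp_smul, finrank_euclideanSpace_fin, abs_of_pos (by positivity),
      smul_eq_mul]
  have e₁ : (fun z => l z * (r ^ d * f (r • z))) =
      fun z => (r ^ d / r) * (l (r • z) * f (r • z)) := by
    ext z; simp only [map_smul, smul_eq_mul]; field_simp
  have e₂ : (fun z => l z * (l z * (r ^ d * f (r • z)))) =
      fun z => (r ^ d / r ^ 2) * (l (r • z) * (l (r • z) * f (r • z))) := by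
    ext z; simp only [map_smul, smul_eq_mul]; field_simp
  refine ⟨(hf.integrable.comp_smul hr0).const_mul _, ?_, ?_, ?_, ?_, ?_⟩
  · rw [e₁]; exact (hf.integrable_first.comp_smul hr0).const_mul _
  · rw [e₂]; exact (hf.integrable_second.comp_smul hr0).const_mul _
  · rw [integral_const_mul, hint, hf.mass]; field_simp
  · rw [e₁, integral_const_mul, hint fun x => l x * f x, hf.first]; simp
  · rw [e₂, integral_const_mul, hint fun x => l x * (l x * f x), hf.second]; field_simp

theorem convIter_mem_Icc {d : ℕ} {f : EuclideanSpace ℝ (Fin d) → ℝ}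
    (hf : ∀ x, f x ∈ Set.Icc 0 1) (hint : Integrable f) (hmass : ∫ x, f x = 1) (n : ℕ)
    (x : EuclideanSpace ℝ (Fin d)) : convIter f n x ∈ Set.Icc 0 1 := by
  induction n generalizing x with
  | zero => exact hf x
  | succ n ih =>
    have hnn (t : EuclideanSpace ℝ (Fin d)) : 0 ≤ f t * convIter f n (x - t) :=
      mul_nonneg (hf t).1 (ih _).1
    refine ⟨integral_nonneg hnn, ?_⟩
    calc ∫ t, f t * convIter f n (x - t) ≤ ∫ t, f t :=
          integral_mono_of_nonneg (.of_forall hnn) hint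
            (.of_forall fun t => mul_le_of_le_one_right (hf t).1 (ih _).2)
      _ = 1 := hmass

/-- Maximum-entropy bound: a probability density bounded by `M` cannot have a small second
moment. -/
theorem exp_neg_le_mul_of_second_moment {d : ℕ} {f : EuclideanSpace ℝ (Fin d) → ℝ} {M a v : ℝ}
    (ha : 0 < a) (hnn : ∀ x, 0 ≤ f x) (hM : ∀ᵐ x, f x ≤ M) (hint : Integrable f)
    (hmass : ∫ x, f x = 1) (hint₂ : Integrable fun x => ‖x‖ ^ 2 * f x)
    (hv : ∫ x, ‖x‖ ^ 2 * f x ≤ v) :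
    Real.exp (-(a * v)) ≤ M * (Real.pi / a) ^ (d / 2 : ℝ) := by
  have hgauss : Integrable fun x : EuclideanSpace ℝ (Fin d) => Real.exp (-a * ‖x‖ ^ 2) := by
    refine .of_integral_ne_zero ?_
    rw [GaussianFourier.integral_rexp_neg_mul_sq_norm ha]
    have := Real.pi_pos
    positivity
  have hmean : ∫ x, Real.exp (-(a * v)) * ((1 + a * v) * f x - a * (‖x‖ ^ 2 * f x)) ≤
      ∫ x : EuclideanSpace ℝ (Fin d), M * Real.exp (-a * ‖x‖ ^ 2) := by
    refine integral_mono_ae (((hint.const_mul _).sub (hint₂.const_mul _)).const_mul _)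
      (hgauss.const_mul _) ?_
    filter_upwards [hM] with x hx
    have htan := Real.add_one_le_exp (a * v - a * ‖x‖ ^ 2)
    calc Real.exp (-(a * v)) * ((1 + a * v) * f x - a * (‖x‖ ^ 2 * f x))
        = f x * (Real.exp (-(a * v)) * (a * v - a * ‖x‖ ^ 2 + 1)) := by ring
      _ ≤ f x * (Real.exp (-(a * v)) * Real.exp (a * v - a * ‖x‖ ^ 2)) := by
        have := hnn x
        gcongr
      _ = f x * Real.exp (-a * ‖x‖ ^ 2) := by rw [← Real.exp_add]; ring_nf
      _ ≤ M * Real.exp (-a * ‖x‖ ^ 2) := by gcongr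
  rw [integral_const_mul, integral_sub (hint.const_mul _) (hint₂.const_mul _),
    integral_const_mul, integral_const_mul, integral_const_mul, hmass,
    GaussianFourier.integral_rexp_neg_mul_sq_norm ha, finrank_euclideanSpace_fin] at hmean
  refine le_trans ?_ hmean
  have : a * ∫ x, ‖x‖ ^ 2 * f x ≤ a * v := by gcongr
  exact le_mul_of_one_le_right (Real.exp_nonneg _) (by linarith)

theorem exp_two_mul_le_of_gaussian_bound {d M : ℝ} (hd : 0 ≤ d)
    (h : Real.exp (-(2 ^ 14 * (d / 2 ^ 15))) ≤ M * (Real.pi / 2 ^ 14) ^ (d / 2)) :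
    Real.exp (2 * d) ≤ M := by
  have hpi := Real.pi_pos
  have hM : 0 < M := pos_of_mul_pos_left ((Real.exp_pos _).trans_le h) (by positivity)
  have hbase : Real.pi / 2 ^ 14 ≤ Real.exp (-5) := by
    have he : Real.exp 5 ≤ 2 ^ 12 := by
      calc Real.exp 5 = Real.exp 1 ^ 5 := by rw [← Real.exp_nat_mul]; norm_num
        _ ≤ 3 ^ 5 := by
          gcongr
          linarith [Real.exp_one_lt_d9]
        _ ≤ 2 ^ 12 := by norm_num
    rw [Real.exp_neg, div_le_iff₀ (by positivity), inv_mul_eq_div, le_div_iff₀ (Real.exp_pos _)]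
    nlinarith [Real.pi_le_four, Real.exp_pos 5]
  have hpow : (Real.pi / 2 ^ 14) ^ (d / 2) ≤ Real.exp (-5 * (d / 2)) := by
    rw [Real.exp_mul]
    exact Real.rpow_le_rpow (by positivity) hbase (by positivity)
  calc Real.exp (2 * d)
      = Real.exp (-(2 ^ 14 * (d / 2 ^ 15))) * Real.exp (5 * (d / 2)) := by
        rw [← Real.exp_add]; ring_nf
    _ ≤ M * Real.exp (-5 * (d / 2)) * Real.exp (5 * (d / 2)) := by
        gcongr
        exact h.trans (by gcongr)
    _ = M := by rw [mul_assoc, ← Real.exp_add]; simp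

theorem hasCenteredMoments_indicator {d : ℕ} {K : Set (EuclideanSpace ℝ (Fin d))}
    (hcpt : IsCompact K) (hvol : volume K = 1) {l : EuclideanSpace ℝ (Fin d) →L[ℝ] ℝ} {s : ℝ}
    (hfirst : ∫ x in K, l x = 0) (hsecond : ∫ x in K, l x * l x = s) :
    HasCenteredMoments l (K.indicator 1) s := by
  have hmeas := hcpt.measurableSet
  have hl := l.continuous
  have e₁ : (fun x => l x * K.indicator 1 x) = K.indicator fun x => l x := by
    ext x; by_cases hx : x ∈ K <;> simp [hx]
  have e₂ : (fun x => l x * (l x * K.indicator 1 x)) = K.indicator fun x => l x * l x := by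
    ext x; by_cases hx : x ∈ K <;> simp [hx]
  refine ⟨?_, ?_, ?_, ?_, ?_, ?_⟩
  · exact (integrable_indicator_iff hmeas).2 (continuousOn_const.integrableOn_compact hcpt)
  · rw [e₁]
    exact (integrable_indicator_iff hmeas).2 (hl.continuousOn.integrableOn_compact hcpt)
  · rw [e₂]
    exact (integrable_indicator_iff hmeas).2 ((hl.mul hl).continuousOn.integrableOn_compact hcpt)
  · simp [integral_indicator_one hmeas, Measure.real, hvol]
  · rw [e₁, integral_indicator hmeas, hfirst]
  · rw [e₂, integral_indicator hmeas, hsecond]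

/-- Let `d ≥ 1`, let `K ⊆ ℝ^d` be a convex body of volume `1` in isotropic position
with `E[X] = 0` and `E[X ⊗ X] = L² I_d` for `X` uniform on `K`, and let `k` satisfy
`2^15 L² ≤ 2^k ≤ 2^16 L²`. Then the density `f_{S_k}` of
`S_k = 2^{-k} ∑_{i=1}^{2^k} X_i` satisfies `‖f_{S_k}‖_∞ ≥ e^{2d}`. -/
theorem essSup_density_lower_bound {d : ℕ} (hd : 1 ≤ d)
    (K : Set (EuclideanSpace ℝ (Fin d)))
    (hcpt : IsCompact K) (hconv : Convex ℝ K) (hint : (interior K).Nonempty)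
    (hvol : volume K = 1) (L : ℝ)
    (hmean : ∀ i : Fin d, ∫ x in K, x i = 0)
    (hcov : ∀ i j : Fin d, ∫ x in K, x i * x j = if i = j then L ^ 2 else 0)
    (k : ℕ) (hk₁ : 2 ^ 15 * L ^ 2 ≤ (2 : ℝ) ^ k) (hk₂ : (2 : ℝ) ^ k ≤ 2 ^ 16 * L ^ 2) :
    essSup (avgDensity K (2 ^ k)) volume ≥ Real.exp (2 * d) := by
  have hnpos : (0 : ℝ) < (2 ^ k : ℕ) := by positivity
  have hind (i : Fin d) : HasCenteredMoments (EuclideanSpace.proj i) (K.indicator 1) (L ^ 2) :=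
    hasCenteredMoments_indicator hcpt hvol (by simpa using hmean i) (by simpa using hcov i i)
  have hmom (i : Fin d) : HasCenteredMoments (EuclideanSpace.proj i) (avgDensity K (2 ^ k))
      (L ^ 2 / 2 ^ k) := by
    have h := ((hind i).convIter (2 ^ k - 1)).rescale hnpos
    have hs : (((2 ^ k - 1 : ℕ) : ℝ) + 1) * L ^ 2 / ((2 ^ k : ℕ) : ℝ) ^ 2 = L ^ 2 / 2 ^ k := by
      rw [Nat.cast_sub Nat.one_le_two_pow]
      push_cast
      field_simp
      ring
    rwa [hs] at h
  have hbdd (z : EuclideanSpace ℝ (Fin d)) :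
      avgDensity K (2 ^ k) z ∈ Set.Icc 0 (((2 ^ k : ℕ) : ℝ) ^ d) := by
    have h := convIter_mem_Icc (f := K.indicator 1)
      (fun x => ⟨Set.indicator_nonneg (by simp) x, Set.indicator_le_self' (by simp) x⟩)
      (hind ⟨0, hd⟩).integrable (hind ⟨0, hd⟩).mass (2 ^ k - 1) (((2 ^ k : ℕ) : ℝ) • z)
    exact ⟨mul_nonneg (by positivity) h.1, mul_le_of_le_one_right (by positivity) h.2⟩
  have hM : ∀ᵐ z, avgDensity K (2 ^ k) z ≤ essSup (avgDensity K (2 ^ k)) volume :=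
    ae_le_essSup ⟨_, Filter.eventually_map.2 (.of_forall fun z => (hbdd z).2)⟩
  have hsum : (fun z => ‖z‖ ^ 2 * avgDensity K (2 ^ k) z) =
      fun z => ∑ i : Fin d, EuclideanSpace.proj (𝕜 := ℝ) i z *
        (EuclideanSpace.proj (𝕜 := ℝ) i z * avgDensity K (2 ^ k) z) := by
    ext z
    rw [EuclideanSpace.real_norm_sq_eq, Finset.sum_mul]
    simp [← mul_assoc, pow_two]
  have hnorm : ∫ z, ‖z‖ ^ 2 * avgDensity K (2 ^ k) z ≤ d / 2 ^ 15 := by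
    rw [hsum, integral_finsetSum _ fun i _ => (hmom i).integrable_second]
    simp only [(hmom _).second, Finset.sum_const, Finset.card_univ, Fintype.card_fin, nsmul_eq_mul]
    rw [div_eq_mul_one_div (d : ℝ)]
    gcongr (d : ℝ) * ?_
    rw [div_le_div_iff₀ (by positivity) (by positivity)]
    linarith
  refine exp_two_mul_le_of_gaussian_bound d.cast_nonneg (exp_neg_le_mul_of_second_moment
    (by positivity) (fun z => (hbdd z).1) hM (hmom ⟨0, hd⟩).integrable (hmom ⟨0, hd⟩).mass ?_ hnorm)
  rw [hsum]
  exact integrable_finsetSum _ fun i _ => (hmom i).integrable_second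
end

section
/- Let K ⊂ ℝ^d be a convex body of volume 1, let X and Y be independent uniformly random points of K, and let A ⊂ ℝ^d be a measurable set with P(X ∈ A) > 0. Then Δ_KB(K) ≥ 2^{−d} · P((X+Y)/2 ∈ A) / P(X ∈ A). -/
open MeasureTheory Pointwise

lemma kbSym_nonneg {d : ℕ} (K : Set (EuclideanSpace ℝ (Fin d))) : 0 ≤ kbSym K :=
  Real.iSup_nonneg fun x => by positivity

lemma measurableSet_add_mem {d : ℕ} {B : Set (EuclideanSpace ℝ (Fin d))} (hB : MeasurableSet B) :
    MeasurableSet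
      {p : EuclideanSpace ℝ (Fin d) × EuclideanSpace ℝ (Fin d) | p.1 + p.2 ∈ B} :=
  (measurable_fst.add measurable_snd) hB

/-- Every overlap `K ∩ (s - K)` of a body of volume `1` has volume at most `Δ_KB(K)`. -/
lemma volume_inter_le_kbSym {d : ℕ} {K : Set (EuclideanSpace ℝ (Fin d))} (hvol : volume K = 1)
    (s : EuclideanSpace ℝ (Fin d)) :
    volume (K ∩ (fun y => s - y) '' K) ≤ ENNReal.ofReal (kbSym K) := by
  have hle (x : EuclideanSpace ℝ (Fin d)) : volume (K ∩ (fun y => x - y) '' K) ≤ 1 :=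
    hvol ▸ measure_mono Set.inter_subset_left
  rw [ENNReal.le_ofReal_iff_toReal_le ((hle s).trans_lt ENNReal.one_lt_top).ne
    (kbSym_nonneg K)]
  have hbdd : BddAbove (Set.range fun x : EuclideanSpace ℝ (Fin d) =>
      (volume (K ∩ (fun y => x - y) '' K)).toReal / (volume K).toReal) := by
    refine ⟨1, ?_⟩
    rintro _ ⟨x, rfl⟩
    simpa [hvol] using ENNReal.toReal_mono ENNReal.one_ne_top (hle x)
  simpa [hvol, kbSym] using le_ciSup hbdd s

/-- The distribution of the sum of two independent uniform points of `K` has density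
at most `Δ_KB(K)`. -/
lemma prod_restrict_add_mem_le {d : ℕ} {K B : Set (EuclideanSpace ℝ (Fin d))}
    (hK : MeasurableSet K) (hvol : volume K = 1) (hB : MeasurableSet B) :
    ((volume.restrict K).prod (volume.restrict K)) {p | p.1 + p.2 ∈ B} ≤
      ENNReal.ofReal (kbSym K) * volume B := by
  set T : Set (EuclideanSpace ℝ (Fin d) × EuclideanSpace ℝ (Fin d)) :=
    {p | p.1 ∈ K ∧ p.2 - p.1 ∈ K ∧ p.2 ∈ B}
  have hT : MeasurableSet T :=
    (measurable_fst hK).inter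
      (((measurable_snd.sub measurable_fst) hK).inter (measurable_snd hB))
  have hshear : {p : EuclideanSpace ℝ (Fin d) × EuclideanSpace ℝ (Fin d) | p.1 + p.2 ∈ B} ∩
      K ×ˢ K = (fun p => (p.1, p.1 + p.2)) ⁻¹' T := by
    ext p
    simp [T]
    tauto
  rw [Measure.prod_restrict, Measure.restrict_apply (measurableSet_add_mem hB), hshear,
    (measurePreserving_prod_add volume volume).measure_preimage hT.nullMeasurableSet,
    Measure.prod_apply_symm hT, ← lintegral_indicator_const hB]
  refine lintegral_mono fun s => ?_
  by_cases hs : s ∈ B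
  · rw [Set.indicator_of_mem hs]
    refine (measure_mono ?_).trans (volume_inter_le_kbSym hvol s)
    rintro x ⟨hx, hsx, -⟩
    exact ⟨hx, s - x, hsx, sub_sub_cancel s x⟩
  · have : (fun x => (x, s)) ⁻¹' T = ∅ := by
      ext x
      simp [T, hs]
    simp [this]

/-- Let `K ⊆ ℝ^d` be a convex body of volume `1`, let `X, Y` be independent uniformly
random points of `K`, and let `A ⊆ ℝ^d` be measurable with `P(X ∈ A) > 0`. Then
`Δ_KB(K) ≥ 2^{-d} · P((X+Y)/2 ∈ A) / P(X ∈ A)`. -/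
theorem kb_from_event_ratio {d : ℕ} (K : Set (EuclideanSpace ℝ (Fin d)))
    (hcpt : IsCompact K) (hconv : Convex ℝ K) (hint : (interior K).Nonempty)
    (hvol : volume K = 1)
    {Ω : Type} [MeasurableSpace Ω] (μ : Measure Ω) [IsProbabilityMeasure μ]
    (X Y : Ω → EuclideanSpace ℝ (Fin d)) (hX : Measurable X) (hY : Measurable Y)
    (hXlaw : μ.map X = volume.restrict K) (hYlaw : μ.map Y = volume.restrict K)
    (hindep : ProbabilityTheory.IndepFun X Y μ)
    (A : Set (EuclideanSpace ℝ (Fin d))) (hA : MeasurableSet A)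
    (hpos : 0 < μ (X ⁻¹' A)) :
    kbSym K ≥ ((2 : ℝ) ^ d)⁻¹ *
      ((μ ((fun ω => (2 : ℝ)⁻¹ • (X ω + Y ω)) ⁻¹' A)).toReal / (μ (X ⁻¹' A)).toReal) := by
  have hK : MeasurableSet K := hcpt.measurableSet
  have hXA : μ (X ⁻¹' A) = volume (A ∩ K) := by
    rw [← Measure.map_apply hX hA, hXlaw, Measure.restrict_apply hA]
  have hXK : ∀ᵐ ω ∂μ, X ω ∈ K :=
    ae_of_ae_map hX.aemeasurable (hXlaw ▸ ae_restrict_mem hK)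
  have hYK : ∀ᵐ ω ∂μ, Y ω ∈ K :=
    ae_of_ae_map hY.aemeasurable (hYlaw ▸ ae_restrict_mem hK)
  set B : Set (EuclideanSpace ℝ (Fin d)) := (fun z => (2 : ℝ)⁻¹ • z) ⁻¹' (A ∩ K)
  have hB : MeasurableSet B := (measurable_const_smul (2 : ℝ)⁻¹) (hA.inter hK)
  have hBvol : volume B = ENNReal.ofReal (2 ^ d) * volume (A ∩ K) := by
    rw [Measure.addHaar_preimage_smul volume (by norm_num : (2 : ℝ)⁻¹ ≠ 0)]
    simp
  have hmid : μ ((fun ω => (2 : ℝ)⁻¹ • (X ω + Y ω)) ⁻¹' A) ≤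
      ((volume.restrict K).prod (volume.restrict K)) {p | p.1 + p.2 ∈ B} := by
    have hlaw := (ProbabilityTheory.indepFun_iff_map_prod_eq_prod_map_map
      hX.aemeasurable hY.aemeasurable).1 hindep
    rw [hXlaw, hYlaw] at hlaw
    rw [← hlaw, Measure.map_apply (hX.prodMk hY) (measurableSet_add_mem hB)]
    refine measure_mono_ae ?_
    filter_upwards [hXK, hYK] with ω hx hy hω
    refine ⟨hω, ?_⟩
    simpa [smul_add] using
      hconv hx hy (by norm_num : (0 : ℝ) ≤ 2⁻¹) (by norm_num : (0 : ℝ) ≤ 2⁻¹) (by norm_num)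
  have hbound := hmid.trans (prod_restrict_add_mem_le hK hvol hB)
  rw [hBvol, ← hXA] at hbound
  have hreal := ENNReal.toReal_mono (by finiteness) hbound
  rw [ENNReal.toReal_mul, ENNReal.toReal_mul, ENNReal.toReal_ofReal (kbSym_nonneg K),
    ENNReal.toReal_ofReal (by positivity)] at hreal
  have hposR : 0 < (μ (X ⁻¹' A)).toReal := ENNReal.toReal_pos hpos.ne' (measure_ne_top _ _)
  rw [ge_iff_le, inv_mul_le_iff₀ (by positivity), div_le_iff₀ hposR]
  linarith
end

section
/- Let d ≥ 1 and let K ⊂ ℝ^d be a convex body of volume 1 with E[X] = 0 and E[X ⊗ X] = L² · I_d for X uniform on K, and let k ∈ ℕ satisfy 2^15 · L² ≤ 2^k ≤ 2^16 · L². Then sup_{z ∈ ℝ^d} 2^d · vol(K ∩ (2z − K)) ≥ e^{d/2^{k−1}}; equivalently, the essential supremum of the density of (X+Y)/2, for X, Y independent uniform points of K, is at least e^{d/2^{k−1}}. -/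
open MeasureTheory Pointwise

section Midpoint

variable {V : Type*} [NormedAddCommGroup V] [InnerProductSpace ℝ V] [FiniteDimensional ℝ V]
  [MeasurableSpace V] [BorelSpace V]

/-- The law of `(X + Y) / 2` for `X`, `Y` independent of law `μ`. -/
noncomputable def midpointLaw (μ : Measure V) : Measure V :=
  (μ.prod μ).map fun p => (2⁻¹ : ℝ) • (p.1 + p.2)

lemma measurable_half_add : Measurable fun p : V × V => (2⁻¹ : ℝ) • (p.1 + p.2) := by
  fun_prop

instance isProbabilityMeasure_midpointLaw (μ : Measure V) [IsProbabilityMeasure μ] :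
    IsProbabilityMeasure (midpointLaw μ) :=
  Measure.isProbabilityMeasure_map measurable_half_add.aemeasurable

lemma midpointLaw_le_smul {μ ν : Measure V} [SFinite μ] [SFinite ν] {c : ENNReal}
    (h : μ ≤ c • ν) : midpointLaw μ ≤ c ^ 2 • midpointLaw ν := by
  have h1 : μ.prod μ ≤ c ^ 2 • ν.prod ν := by
    calc μ.prod μ ≤ (c • ν).prod (c • ν) := Measure.prod_mono h h
      _ = c ^ 2 • ν.prod ν := by
        rw [Measure.prod_smul_left, Measure.prod_smul_right, smul_smul, sq]
  calc midpointLaw μ ≤ (c ^ 2 • ν.prod ν).map _ := Measure.map_mono h1 measurable_half_add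
    _ = c ^ 2 • midpointLaw ν := Measure.map_smul ..

lemma volume_eq_two_pow_mul_volume_preimage (x : V) (S : Set V) :
    volume S = 2 ^ Module.finrank ℝ V * volume {z : V | (2 : ℝ) • z - x ∈ S} := by
  have h : {z : V | (2 : ℝ) • z - x ∈ S} =
      (fun z : V => (2 : ℝ) • z) ⁻¹' ((fun y => y + -x) ⁻¹' S) := by
    simp only [sub_eq_add_neg]
    rfl
  rw [h, Measure.addHaar_preimage_smul _ two_ne_zero, measure_preimage_add_right, ← mul_assoc,
    abs_of_pos (by positivity), ENNReal.ofReal_inv_of_pos (by positivity),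
    ENNReal.ofReal_pow zero_le_two, ENNReal.ofReal_ofNat, ENNReal.mul_inv_cancel (by simp) (by simp),
    one_mul]

lemma midpointLaw_restrict_le {K : Set V} (hK : MeasurableSet K) (hconv : Convex ℝ K)
    {M : ENNReal}
    (hM : ∀ z : V, 2 ^ Module.finrank ℝ V *
      volume (K ∩ (fun w => (2 : ℝ) • z - w) '' K) ≤ M) :
    midpointLaw (volume.restrict K) ≤ M • volume.restrict K := by
  refine Measure.le_iff.2 fun B hB => ?_
  have hS : MeasurableSet {p : V × V | p.2 ∈ B ∧ (2 : ℝ) • p.2 - p.1 ∈ K} :=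
    (measurable_snd hB).inter
      ((show Measurable fun p : V × V => (2 : ℝ) • p.2 - p.1 by fun_prop) hK)
  have hfib : ∀ x : V, (volume.restrict K) (Prod.mk x ⁻¹'
      ((fun p : V × V => (2⁻¹ : ℝ) • (p.1 + p.2)) ⁻¹' B)) =
      2 ^ Module.finrank ℝ V *
        volume (Prod.mk x ⁻¹' {p : V × V | p.2 ∈ B ∧ (2 : ℝ) • p.2 - p.1 ∈ K}) := by
    intro x
    rw [Measure.restrict_apply (measurable_prodMk_left (measurable_half_add hB)),
      volume_eq_two_pow_mul_volume_preimage x]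
    congr 2
    ext z
    have hz : (2⁻¹ : ℝ) • (x + ((2 : ℝ) • z - x)) = z := by
      rw [add_sub_cancel, smul_smul, inv_mul_cancel₀ two_ne_zero, one_smul]
    simp only [Set.mem_ofPred_eq, Set.mem_inter_iff, Set.mem_preimage, hz]
  rw [midpointLaw, Measure.map_apply measurable_half_add hB,
    Measure.prod_apply (measurable_half_add hB)]
  simp_rw [hfib]
  rw [lintegral_const_mul _ (measurable_measure_prodMk_left hS), ← Measure.prod_apply hS,
    Measure.prod_apply_symm hS,
    ← lintegral_const_mul _ (measurable_measure_prodMk_right hS), Measure.smul_apply,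
    smul_eq_mul, Measure.restrict_apply hB, ← setLIntegral_const,
    ← lintegral_indicator (hB.inter hK)]
  refine lintegral_mono fun z => ?_
  rw [Measure.restrict_apply (measurable_prodMk_right hS)]
  by_cases hz : z ∈ B ∩ K
  · rw [Set.indicator_of_mem hz]
    refine le_trans ?_ (hM z)
    refine mul_le_mul_right (measure_mono ?_) _
    intro x ⟨hx, hxK⟩
    exact ⟨hxK, _, hx.2, by simp⟩
  · rw [Set.indicator_of_notMem hz]
    suffices (fun x => (x, z)) ⁻¹' {p : V × V | p.2 ∈ B ∧ (2 : ℝ) • p.2 - p.1 ∈ K} ∩ K = ∅ by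
      rw [this, measure_empty, mul_zero]
    refine Set.eq_empty_of_forall_notMem ?_
    intro x ⟨hx, hxK⟩
    refine hz ⟨hx.1, ?_⟩
    have := hconv hxK hx.2 (show (0 : ℝ) ≤ 2⁻¹ by norm_num) (show (0 : ℝ) ≤ 2⁻¹ by norm_num)
      (by norm_num)
    rwa [← smul_add, add_sub_cancel, smul_smul, inv_mul_cancel₀ two_ne_zero, one_smul] at this

lemma iterate_midpointLaw_restrict_le {K : Set V} [IsProbabilityMeasure (volume.restrict K)]
    {M : ENNReal} (h : midpointLaw (volume.restrict K) ≤ M • volume.restrict K) (n : ℕ) :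
    IsProbabilityMeasure (midpointLaw^[n] (volume.restrict K)) ∧
      midpointLaw^[n] (volume.restrict K) ≤ M ^ (2 ^ n - 1) • volume.restrict K := by
  induction n with
  | zero => simpa
  | succ n ih =>
    obtain ⟨hp, hle⟩ := ih
    rw [Function.iterate_succ_apply']
    refine ⟨inferInstance, ?_⟩
    calc _ ≤ (M ^ (2 ^ n - 1)) ^ 2 • midpointLaw (volume.restrict K) := midpointLaw_le_smul hle
      _ ≤ (M ^ (2 ^ n - 1)) ^ 2 • M • volume.restrict K := by gcongr
      _ = _ := by
        rw [smul_smul, ← pow_mul, ← pow_succ]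
        congr 2
        have := Nat.one_le_two_pow (n := n)
        rw [pow_succ]
        omega

/-- A law with zero mean has its second moment halved by `midpointLaw`. -/
lemma second_moment_midpointLaw {μ : Measure V} [IsProbabilityMeasure μ]
    (h1 : Integrable (fun x => x) μ) (h2 : Integrable (fun x => ‖x‖ ^ 2) μ)
    (hmean : ∫ x, x ∂μ = 0) :
    Integrable (fun x => x) (midpointLaw μ) ∧
      Integrable (fun x => ‖x‖ ^ 2) (midpointLaw μ) ∧
      ∫ x, x ∂(midpointLaw μ) = 0 ∧
      ∫ x, ‖x‖ ^ 2 ∂(midpointLaw μ) = (∫ x, ‖x‖ ^ 2 ∂μ) / 2 := by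
  have hsq : ∀ p : V × V, ‖(2⁻¹ : ℝ) • (p.1 + p.2)‖ ^ 2 =
      4⁻¹ * (‖p.1‖ ^ 2 + ‖p.2‖ ^ 2 + 2 * inner ℝ p.1 p.2) := by
    intro p
    rw [norm_smul, mul_pow, norm_add_sq_real]
    norm_num
    ring
  have ha : Integrable (fun p : V × V => ‖p.1‖ ^ 2) (μ.prod μ) := h2.comp_fst μ
  have hb : Integrable (fun p : V × V => ‖p.2‖ ^ 2) (μ.prod μ) := h2.comp_snd μ
  have hc : Integrable (fun p : V × V => inner ℝ p.1 p.2) (μ.prod μ) := by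
    refine (ha.add hb).mono' (by fun_prop) (.of_forall fun p => ?_)
    have := norm_inner_le_norm (𝕜 := ℝ) p.1 p.2
    simp only [Pi.add_apply]
    nlinarith [sq_nonneg (‖p.1‖ - ‖p.2‖), sq_nonneg (‖p.1‖), sq_nonneg (‖p.2‖)]
  have hab : Integrable (fun p : V × V => ‖p.1‖ ^ 2 + ‖p.2‖ ^ 2) (μ.prod μ) := ha.add hb
  have hm := (measurable_half_add (V := V)).aemeasurable (μ := μ.prod μ)
  have hid : AEStronglyMeasurable (fun x : V => x) (midpointLaw μ) := by fun_prop
  have hn : AEStronglyMeasurable (fun x : V => ‖x‖ ^ 2) (midpointLaw μ) := by fun_prop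
  refine ⟨(integrable_map_measure hid hm).2 (((h1.comp_fst μ).add (h1.comp_snd μ)).smul _),
    (integrable_map_measure hn hm).2 ?_, ?_, ?_⟩
  · exact ((hab.add (hc.const_mul 2)).const_mul 4⁻¹).congr
      (.of_forall fun p => (hsq p).symm)
  · rw [midpointLaw, integral_map hm hid, integral_smul,
      integral_add (h1.comp_fst μ) (h1.comp_snd μ), integral_fun_fst (fun x : V => x),
      integral_fun_snd (fun x : V => x), hmean]
    simp
  · rw [midpointLaw, integral_map hm hn]
    simp_rw [hsq]
    rw [integral_const_mul, integral_add hab (hc.const_mul 2), integral_const_mul,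
      integral_add ha hb, integral_fun_fst (fun x : V => ‖x‖ ^ 2),
      integral_fun_snd (fun x : V => ‖x‖ ^ 2), integral_prod _ hc]
    simp_rw [integral_inner h1, hmean]
    simp
    ring

lemma second_moment_iterate_midpointLaw {μ : Measure V} [IsProbabilityMeasure μ]
    (h1 : Integrable (fun x => x) μ) (h2 : Integrable (fun x => ‖x‖ ^ 2) μ)
    (hmean : ∫ x, x ∂μ = 0) (n : ℕ) :
    Integrable (fun x => ‖x‖ ^ 2) (midpointLaw^[n] μ) ∧
      ∫ x, ‖x‖ ^ 2 ∂(midpointLaw^[n] μ) = (∫ x, ‖x‖ ^ 2 ∂μ) / 2 ^ n := by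
  induction n generalizing μ with
  | zero => simpa
  | succ n ih =>
    obtain ⟨k1, k2, k3, k4⟩ := second_moment_midpointLaw h1 h2 hmean
    obtain ⟨i1, i2⟩ := ih k1 k2 k3
    rw [Function.iterate_succ_apply]
    refine ⟨i1, ?_⟩
    rw [i2, k4, pow_succ']
    field_simp

/-- A probability measure of small second moment with density at most `C` forces `C` to be
large: its Gaussian integral is bounded below by Jensen's inequality. -/
lemma exp_neg_le_mul_gaussian {μ : Measure V} [IsProbabilityMeasure μ] {C : ℝ} (hC : 0 ≤ C)
    (hμ : μ ≤ ENNReal.ofReal C • volume) (h2 : Integrable (fun x => ‖x‖ ^ 2) μ) {b : ℝ}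
    (hb : 0 < b) :
    Real.exp (-b * ∫ x, ‖x‖ ^ 2 ∂μ) ≤ C * (Real.pi / b) ^ (Module.finrank ℝ V / 2 : ℝ) := by
  have hint : Integrable (fun v : V => Real.exp (-b * ‖v‖ ^ 2)) := by
    refine Integrable.of_integral_ne_zero ?_
    rw [GaussianFourier.integral_rexp_neg_mul_sq_norm hb]
    positivity
  have hintC := hint.smul_measure (c := ENNReal.ofReal C) ENNReal.ofReal_ne_top
  calc Real.exp (-b * ∫ x, ‖x‖ ^ 2 ∂μ) = Real.exp (∫ x, -b * ‖x‖ ^ 2 ∂μ) := by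
        rw [integral_const_mul]
    _ ≤ ∫ x, Real.exp (-b * ‖x‖ ^ 2) ∂μ :=
      convexOn_exp.map_integral_le Real.continuous_exp.continuousOn isClosed_univ (by simp)
        (h2.const_mul _) (hintC.mono_measure hμ)
    _ ≤ ∫ x, Real.exp (-b * ‖x‖ ^ 2) ∂(ENNReal.ofReal C • (volume : Measure V)) :=
      integral_mono_measure hμ (.of_forall fun x => (Real.exp_pos _).le) hintC
    _ = _ := by
      rw [integral_smul_measure, GaussianFourier.integral_rexp_neg_mul_sq_norm hb,
        ENNReal.toReal_ofReal hC, smul_eq_mul]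

end Midpoint

/-- Let `d ≥ 1` and let `K ⊆ ℝ^d` be a convex body of volume `1` with `E[X] = 0` and
`E[X ⊗ X] = L² I_d` for `X` uniform on `K`, and let `k ∈ ℕ` satisfy
`2^15 L² ≤ 2^k ≤ 2^16 L²`. Then `sup_z 2^d · vol(K ∩ (2z - K)) ≥ e^{d / 2^{k-1}}`;
equivalently, the sup of the density of `(X+Y)/2` for `X, Y` independent uniform points
of `K` is at least `e^{d / 2^{k-1}}`. -/
theorem sup_midpoint_density {d : ℕ} (hd : 1 ≤ d)
    (K : Set (EuclideanSpace ℝ (Fin d)))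
    (hcpt : IsCompact K) (hconv : Convex ℝ K) (hint : (interior K).Nonempty)
    (hvol : volume K = 1) (L : ℝ)
    (hmean : ∀ i : Fin d, ∫ x in K, x i = 0)
    (hcov : ∀ i j : Fin d, ∫ x in K, x i * x j = if i = j then L ^ 2 else 0)
    (k : ℕ) (hk₁ : 2 ^ 15 * L ^ 2 ≤ (2 : ℝ) ^ k) (hk₂ : (2 : ℝ) ^ k ≤ 2 ^ 16 * L ^ 2) :
    (⨆ z : EuclideanSpace ℝ (Fin d),
        (2 : ℝ) ^ d * (volume (K ∩ (fun w => (2 : ℝ) • z - w) '' K)).toReal) ≥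
      Real.exp ((d : ℝ) / 2 ^ (k - 1)) := by
  set f : EuclideanSpace ℝ (Fin d) → ℝ := fun z =>
    (2 : ℝ) ^ d * (volume (K ∩ (fun w => (2 : ℝ) • z - w) '' K)).toReal with hf
  set M : ℝ := ⨆ z, f z with hMdef
  have hle_one : ∀ z : EuclideanSpace ℝ (Fin d),
      volume (K ∩ (fun w => (2 : ℝ) • z - w) '' K) ≤ 1 := fun z =>
    (measure_mono Set.inter_subset_left).trans hvol.le
  have hbdd : BddAbove (Set.range f) := by
    refine ⟨2 ^ d, ?_⟩
    rintro _ ⟨z, rfl⟩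
    exact mul_le_of_le_one_right (by positivity)
      (ENNReal.toReal_mono ENNReal.one_ne_top (hle_one z))
  have hM0 : 0 ≤ M := Real.iSup_nonneg fun z => by positivity
  have hprob : IsProbabilityMeasure (volume.restrict K) := ⟨by simpa using hvol⟩
  have hmid : midpointLaw (volume.restrict K) ≤ ENNReal.ofReal M • volume.restrict K := by
    refine midpointLaw_restrict_le hcpt.measurableSet hconv fun z => ?_
    have hz : volume (K ∩ (fun w => (2 : ℝ) • z - w) '' K) ≠ ⊤ :=
      ((hle_one z).trans_lt ENNReal.one_lt_top).ne
    calc _ = ENNReal.ofReal (f z) := by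
          rw [hf, ENNReal.ofReal_mul (by positivity), ENNReal.ofReal_toReal hz,
            ENNReal.ofReal_pow zero_le_two, ENNReal.ofReal_ofNat, finrank_euclideanSpace_fin]
      _ ≤ ENNReal.ofReal M := ENNReal.ofReal_le_ofReal (le_ciSup hbdd z)
  obtain ⟨hpk, hlek⟩ := iterate_midpointLaw_restrict_le hmid k
  have hcont : ∀ {F : Type} [NormedAddCommGroup F] {g : EuclideanSpace ℝ (Fin d) → F},
      Continuous g → Integrable g (volume.restrict K) := fun hg =>
    hg.continuousOn.integrableOn_compact hcpt
  have hmean' : ∫ x in K, x = 0 := by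
    ext i
    have := (EuclideanSpace.proj (𝕜 := ℝ) i).integral_comp_comm
      (hcont (continuous_id (X := EuclideanSpace ℝ (Fin d))))
    simpa [hmean i] using this.symm
  have hsecond : ∫ x in K, ‖x‖ ^ 2 = d * L ^ 2 := by
    simp_rw [EuclideanSpace.real_norm_sq_eq]
    rw [integral_finsetSum _ fun i _ => hcont (by fun_prop)]
    simp [sq, hcov]
  obtain ⟨hik, hsk⟩ := second_moment_iterate_midpointLaw (hcont continuous_id)
    (hcont (continuous_norm.pow 2)) hmean' k
  rw [hsecond] at hsk
  have hlek' : midpointLaw^[k] (volume.restrict K) ≤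
      ENNReal.ofReal (M ^ (2 ^ k - 1)) • volume := by
    rw [ENNReal.ofReal_pow hM0]
    refine hlek.trans ?_
    gcongr
    exact Measure.restrict_le_self
  have hgauss := exp_neg_le_mul_gaussian (pow_nonneg hM0 _) hlek' hik
    (b := Real.pi * Real.exp 6) (by positivity)
  have hpow : (Real.pi / (Real.pi * Real.exp 6)) ^
      (Module.finrank ℝ (EuclideanSpace ℝ (Fin d)) / 2 : ℝ) = Real.exp (-(3 * d)) := by
    rw [finrank_euclideanSpace_fin, div_mul_cancel_left₀ Real.pi_ne_zero, ← Real.exp_neg,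
      ← Real.exp_mul]
    congr 1
    ring
  have hb : Real.pi * Real.exp 6 ≤ 2 ^ 15 := by
    have h6 : Real.exp 6 ≤ 3 ^ 6 := by
      rw [show (6 : ℝ) = (6 : ℕ) * 1 by norm_num, Real.exp_nat_mul]
      gcongr
      exact Real.exp_one_lt_three.le
    calc Real.pi * Real.exp 6 ≤ 4 * 3 ^ 6 := by
          gcongr
          exact Real.pi_le_four
      _ ≤ 2 ^ 15 := by norm_num
  have hexp : Real.pi * Real.exp 6 * (d * L ^ 2 / 2 ^ k) ≤ d := by
    calc Real.pi * Real.exp 6 * (d * L ^ 2 / 2 ^ k) ≤ 2 ^ 15 * (d * L ^ 2 / 2 ^ k) := by gcongr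
      _ = d * (2 ^ 15 * L ^ 2) / 2 ^ k := by ring
      _ ≤ d * 2 ^ k / 2 ^ k := by gcongr
      _ = d := by field_simp
  rw [hpow, hsk] at hgauss
  have hlow : Real.exp (2 * d) ≤ M ^ (2 ^ k - 1) := by
    refine le_of_mul_le_mul_right (le_trans ?_ hgauss) (Real.exp_pos _)
    rw [← Real.exp_add, Real.exp_le_exp]
    linarith
  by_contra! hlt
  have hdpos : (0 : ℝ) < d := by exact_mod_cast hd
  have hup : M ^ (2 ^ k - 1) ≤ Real.exp ((2 ^ k - 1 : ℕ) * (d / 2 ^ (k - 1))) := by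
    rw [Real.exp_nat_mul]
    gcongr
  have hle := Real.exp_le_exp.1 (hlow.trans hup)
  have hcount : ((2 ^ k - 1 : ℕ) : ℝ) < 2 * 2 ^ (k - 1) := by
    rcases k with _ | k
    · norm_num
    · have h : 2 ^ (k + 1) - 1 < 2 * 2 ^ k := by
        have := Nat.one_le_two_pow (n := k)
        rw [pow_succ]
        omega
      exact_mod_cast h
  have : ((2 ^ k - 1 : ℕ) : ℝ) * (d / 2 ^ (k - 1)) < 2 * d := by
    rw [← mul_div_assoc, div_lt_iff₀ (by positivity)]
    nlinarith
  linarith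
end
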